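/- Let p be a prime, n ≥ 1, q = p^n, k a divisor of n, v ≥ 1 a divisor of p^k − 1, and let U be an 𝔽_{p^k}-subspace of 𝔽_q with 1 ∈ U, #U = p^{mk}, and #U^v > 2. Assume (p·#U^v)² > p^n (i.e., #U^v > p^{n/2 − 1}). If U ≠ {c ∈ 𝔽_q : c^{p^{mk}} = c}, then 𝒫(U^v, q) = {f^v : f ∈ 𝒫(U, q)}. If U = {c ∈ 𝔽_q : c^{p^{mk}} = c}, then, letting e be the smallest positive integer such that s^{p^e} = s for all s ∈ U^v and t = v·(p^e − 1)/(p^{mk} − 1), one has 𝒫(U^v, q) = {f^t : f ∈ 𝒫(𝔽_{p^e}, q)}. -/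

import Mathlib

open Polynomial

/-- The value set of a polynomial over a finite field. -/
def valueSet {F : Type*} [Field F] [Fintype F] [DecidableEq F] (f : F[X]) : Finset F :=
  Finset.image (fun a => f.eval a) Finset.univ

/-- A minimal value set polynomial (MVSP): a nonconstant polynomial whose value set has
the minimal possible size `⌊(q-1)/deg f⌋ + 1`. -/
def IsMVSP {F : Type*} [Field F] [Fintype F] [DecidableEq F] (f : F[X]) : Prop :=
  0 < f.natDegree ∧ (valueSet f).card = (Fintype.card F - 1) / f.natDegree + 1

/-- `MVSPset S` is the set `𝒫(S, q)` of all MVSPs with value set `S`. -/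
def MVSPset {F : Type*} [Field F] [Fintype F] [DecidableEq F] (S : Finset F) : Set F[X] :=
  {f | IsMVSP f ∧ valueSet f = S}

/-- `U` is a subspace over the subfield `{c : c ^ r = c}` (with `r = p ^ k`):
an additive subgroup closed under multiplication by elements of that subfield. -/
def IsSubspaceOver {F : Type*} [Field F] (r : ℕ) (U : Set F) : Prop :=
  (0 : F) ∈ U ∧ (∀ x ∈ U, ∀ y ∈ U, x + y ∈ U) ∧ (∀ x ∈ U, -x ∈ U) ∧
    (∀ c : F, c ^ r = c → ∀ x ∈ U, c * x ∈ U)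

/-- An `r`-linearized polynomial (with `r = q` or `r = p ^ k`): of the form `Σ aᵢ x ^ (r ^ i)`. -/
def IsLinearized {F : Type*} [Field F] (r : ℕ) (M : F[X]) : Prop :=
  ∃ (s : ℕ) (a : ℕ → F), M = ∑ i ∈ Finset.range (s + 1), C (a i) * X ^ r ^ i


namespace MV
variable {F : Type*} [Field F]

lemma dvd_of_pow_dvd {a b : F[X]} {k : ℕ} (hk : k ≠ 0) (h : a ^ k ∣ b ^ k) : a ∣ b :=
  (UniqueFactorizationMonoid.pow_dvd_pow_iff_dvd hk).mp h

lemma prod_univ [Fintype F] :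
    (X ^ (Fintype.card F) - X : F[X]) = ∏ a : F, (X - C a) := by
  have h1 : 1 < Fintype.card F := Fintype.one_lt_card
  have hm : (X ^ (Fintype.card F) - X : F[X]).Monic := by
    apply monic_X_pow_sub
    rw [degree_X]; exact_mod_cast h1
  have hr := FiniteField.roots_X_pow_card_sub_X F
  have := prod_multiset_X_sub_C_of_monic_of_roots_card_eq hm (by
    rw [hr, FiniteField.X_pow_card_sub_X_natDegree_eq F h1]; simp)
  rw [hr] at this
  rw [← this]; rfl

lemma prod_dvd_of_roots (Z : Finset F) (f : F[X]) (h : ∀ a ∈ Z, f.eval a = 0) :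
    (∏ a ∈ Z, (X - C a)) ∣ f := by
  apply Finset.prod_dvd_of_coprime
  · intro a _ b _ hab
    exact (pairwise_coprime_X_sub_C Function.injective_id) hab
  · intro a ha; exact dvd_iff_isRoot.mpr (h a ha)

/-- Step 1. -/
lemma step1 [Fintype F] {p : ℕ} [CharP F p] {n : ℕ} (hn : 0 < n) (hq : Fintype.card F = p ^ n) {v r : ℕ} (hr : 2 ≤ r)
    {W : F[X]} (hWd : W.natDegree = r) {a0 : F}
    (hW1 : C (v : F) * X * derivative W + W = C a0) {g : F[X]} (hg : 0 < g.natDegree)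
    (hd : r * g.natDegree < p ^ n)
    (hz : ∀ a : F, g.eval a * W.eval (g.eval a) = 0) :
    C (v : F) * g * W.comp g = - C a0 * (X ^ (p ^ n) - X) * derivative g := by
  have hP := prod_univ (F := F)
  rw [hq] at hP
  have h1 : 1 < p ^ n := by rw [← hq]; exact Fintype.one_lt_card
  obtain ⟨H, hH⟩ : (X ^ (p ^ n) - X : F[X]) ∣ g * W.comp g := by
    rw [hP]; apply prod_dvd_of_roots; intro a _; simp [eval_comp, hz a]
  have hg0 : g ≠ 0 := by rintro rfl; simp at hg
  have hPd : (X ^ (p ^ n) - X : F[X]).natDegree = p ^ n :=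
    FiniteField.X_pow_card_sub_X_natDegree_eq F h1
  have hP0 : (X ^ (p ^ n) - X : F[X]) ≠ 0 := FiniteField.X_pow_card_sub_X_ne_zero F h1
  have hWg : (W.comp g).natDegree = r * g.natDegree := by rw [natDegree_comp, hWd]
  have hWg0 : W.comp g ≠ 0 := by
    intro h; rw [h] at hWg; simp at hWg; omega
  have hH0 : H ≠ 0 := by
    rintro rfl; rw [mul_zero] at hH; exact (mul_ne_zero hg0 hWg0) hH
  have hHd : H.natDegree < g.natDegree := by
    have := congrArg natDegree hH
    rw [natDegree_mul hg0 hWg0, natDegree_mul hP0 hH0, hPd, hWg] at this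
    omega
  have hdP : derivative (X ^ (p ^ n) - X : F[X]) = -1 := by
    simp [derivative_X_pow, hn.ne']
  have hW1c : C (v : F) * g * (derivative W).comp g + W.comp g = C a0 := by
    have := congrArg (fun f => f.comp g) hW1
    simpa using this
  have hder := congrArg derivative hH
  rw [derivative_mul, derivative_comp, derivative_mul, hdP] at hder
  have key : g * (C a0 * derivative g + C (v:F) * H) =
      (X ^ (p ^ n) - X) * (C (v:F) * derivative H * g - (C (v:F) - 1) * H * derivative g) := by
    linear_combination (- g * derivative g) * hW1c + C (v:F) * g * hder - (C (v:F) - 1) * derivative g * hH 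
  have hzero : g * (C a0 * derivative g + C (v:F) * H) = 0 := by
    by_contra hne
    have hle : p ^ n ≤ (g * (C a0 * derivative g + C (v:F) * H)).natDegree := by
      rw [← hPd]; exact natDegree_le_of_dvd ⟨_, key⟩ hne
    have h2 : (C a0 * derivative g + C (v:F) * H).natDegree < g.natDegree := by
      apply lt_of_le_of_lt (natDegree_add_le _ _)
      apply max_lt
      · exact lt_of_le_of_lt (natDegree_C_mul_le _ _) (natDegree_derivative_lt (by omega))
      · exact lt_of_le_of_lt (natDegree_C_mul_le _ _) hHd
    have h3 := natDegree_mul_le (p := g) (q := (C a0 * derivative g + C (v:F) * H))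
    nlinarith
  have h4 : C a0 * derivative g + C (v:F) * H = 0 := by
    rcases mul_eq_zero.mp hzero with h | h
    · exact absurd h hg0
    · exact h
  linear_combination C (v:F) * hH + (X ^ (p^n) - X) * h4

/-- Step 2. -/
lemma step2 [Fintype F] {p : ℕ} [CharP F p] {n : ℕ} (hn : 0 < n) (hq : Fintype.card F = p ^ n) {v r : ℕ} (hr : 2 ≤ r)
    (hv0 : (v : F) ≠ 0)
    {W : F[X]} (hWd : W.natDegree = r) {a0 : F} (ha0 : a0 ≠ 0)
    (hW1 : C (v : F) * X * derivative W + W = C a0) {g : F[X]} (hg : 0 < g.natDegree)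
    (hd : r * g.natDegree < p ^ n)
    (hz : ∀ a : F, g.eval a * W.eval (g.eval a) = 0) :
    ∃ (L D : F[X]) (α : F) (μ : ℕ), L.Monic ∧ L * D = X ^ (p ^ n) - X ∧
      W.comp g = - C a0 * D * derivative L ∧ derivative (derivative L) = 0 ∧ L ∣ g ∧
      0 < L.natDegree ∧ L.eval α = 0 ∧ L ^ μ ∣ g ∧ g.rootMultiplicity α = μ := by
  classical
  have hs1 := step1 hn hq hr hWd hW1 hg hd hz
  have hP := prod_univ (F := F)
  rw [hq] at hP
  have hg0 : g ≠ 0 := by rintro rfl; simp at hg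
  have hWg : (W.comp g).natDegree = r * g.natDegree := by rw [natDegree_comp, hWd]
  have hWg0 : W.comp g ≠ 0 := by
    intro h; rw [h] at hWg; simp at hWg; omega
  set Z : Finset F := Finset.univ.filter (fun a => g.eval a = 0) with hZ
  set L : F[X] := ∏ a ∈ Z, (X - C a) with hL
  set D : F[X] := ∏ a ∈ Finset.univ.filter (fun a => ¬ g.eval a = 0), (X - C a) with hD
  have hLm : L.Monic := monic_prod_of_monic _ _ (fun a _ => monic_X_sub_C a)
  have hDm : D.Monic := monic_prod_of_monic _ _ (fun a _ => monic_X_sub_C a)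
  have hLD : L * D = X ^ (p ^ n) - X := by
    rw [hP, hL, hD, hZ]; exact Finset.prod_filter_mul_prod_filter_not _ _ _
  have hDg : IsCoprime D g := by
    apply IsCoprime.prod_left
    intro a ha
    rw [Finset.mem_filter] at ha
    exact ((irreducible_X_sub_C a).coprime_iff_not_dvd).mpr (fun h => ha.2 (dvd_iff_isRoot.mp h))
  have hLg : L ∣ g := prod_dvd_of_roots _ _ (fun a ha => (Finset.mem_filter.mp ha).2)
  have hLroot : ∀ a ∈ Z, L.eval a = 0 := by
    intro a ha
    rw [hL, eval_prod]; exact Finset.prod_eq_zero ha (by simp)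
  obtain ⟨K, hK⟩ : g ∣ L * derivative g := by
    apply hDg.symm.dvd_of_dvd_mul_left
    have : g ∣ C a0 * (D * (L * derivative g)) := by
      refine ⟨- C (v:F) * W.comp g, ?_⟩
      rw [← hLD] at hs1
      linear_combination hs1
    exact (dvd_C_mul ha0).mp this
  have hWK : C (v:F) * W.comp g = - C a0 * D * K := by
    apply mul_left_cancel₀ hg0
    rw [← hLD] at hs1
    linear_combination hs1 - C a0 * D * hK 
  have hdLD : derivative L * D + L * derivative D = -1 := by
    rw [← derivative_mul, hLD]
    simp [derivative_X_pow, hn.ne']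
  have hWe : W.eval 0 = a0 := by
    have := congrArg (eval 0) hW1
    simpa using this
  have hKL : K = C (v:F) * derivative L := by
    rw [← sub_eq_zero]
    by_contra hne
    have hdv : L ∣ K - C (v:F) * derivative L := by
      apply prod_dvd_of_roots
      intro a ha
      have hga := (Finset.mem_filter.mp ha).2
      have e1 := congrArg (eval a) hWK
      have e2 := congrArg (eval a) hdLD
      simp [eval_comp, hga, hWe, hLroot a ha] at e1 e2
      have hDa : eval a D ≠ 0 := by
        intro h; rw [h] at e2; simp at e2
      simp
      have : a0 * eval a D * (eval a K - v * eval a (derivative L)) = 0 := by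
        linear_combination e1 - a0 * v * e2
      rcases mul_eq_zero.mp this with h | h
      · exact absurd h (mul_ne_zero ha0 hDa)
      · exact h
    have h1 := degree_le_of_dvd hdv hne
    have h2 : (K - C (v:F) * derivative L).degree < L.degree := by
      apply lt_of_le_of_lt (degree_sub_le _ _)
      apply max_lt
      · by_cases hK0 : K = 0
        · rw [hK0, degree_zero]; exact bot_lt_iff_ne_bot.mpr (by simpa using hLm.ne_zero)
        · have := congrArg natDegree hK
          have hdg0 : derivative g ≠ 0 := by
            intro h; rw [h, mul_zero] at hK
            exact (mul_ne_zero hg0 hK0) hK.symm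
          rw [natDegree_mul hLm.ne_zero hdg0, natDegree_mul hg0 hK0] at this
          apply degree_lt_degree
          have := natDegree_derivative_lt (p := g) (by omega)
          omega
      · rw [degree_C_mul hv0]; exact degree_derivative_lt hLm.ne_zero
    exact absurd h1 (not_le.mpr h2)
  have hCv : C (v:F) ≠ 0 := C_ne_zero.mpr hv0
  have hCa : C a0 ≠ 0 := C_ne_zero.mpr ha0
  have hWL : W.comp g = - C a0 * D * derivative L := by
    apply mul_left_cancel₀ hCv
    rw [hWK, hKL]; ring
  have hLL : L * derivative g = C (v:F) * g * derivative L := by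
    rw [hK, hKL]; ring
  have hW1c : C (v : F) * g * (derivative W).comp g + W.comp g = C a0 := by
    have := congrArg (fun f => f.comp g) hW1
    simpa using this
  have hL2 : derivative (derivative L) = 0 := by
    have e := congrArg derivative hWL
    rw [derivative_comp] at e
    simp only [derivative_mul, derivative_neg, derivative_C] at e
    have : C a0 * C (v:F) * g * D * derivative (derivative L) = 0 := by
      linear_combination C (v:F) * g * e - derivative g * hW1c + derivative g * hWL - C a0 * derivative g * hdLD + C a0 * derivative D * hLL
    have h2 : C a0 * C (v:F) * g * D ≠ 0 :=
      mul_ne_zero (mul_ne_zero (mul_ne_zero hCa hCv) hg0) hDm.ne_zero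
    exact (mul_eq_zero.mp this).resolve_left h2
  have hLpos : 0 < L.natDegree := by
    by_contra h
    have : derivative L = 0 := by
      have : L = 1 := by
        exact hLm.natDegree_eq_zero.mp (by omega)
      rw [this]; simp
    rw [this, mul_zero] at hWL
    exact hWg0 hWL
  have hZne : Z.Nonempty := by
    rw [Finset.nonempty_iff_ne_empty]; intro h
    rw [hL, h] at hLpos; simp at hLpos
  obtain ⟨α, hα, hmin⟩ := Finset.exists_min_image Z (fun a => g.rootMultiplicity a) hZne
  refine ⟨L, D, α, g.rootMultiplicity α, hLm, hLD, hWL, hL2, hLg, hLpos, hLroot α hα, ?_, rfl⟩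
  rw [hL, ← Finset.prod_pow]
  apply Finset.prod_dvd_of_coprime
  · intro a _ b _ hab
    exact (IsCoprime.pow ((pairwise_coprime_X_sub_C Function.injective_id) hab))
  · intro a ha
    exact (pow_dvd_pow _ (hmin a ha)).trans (pow_rootMultiplicity_dvd g a)
end MV


namespace MV
variable {F : Type*} [Field F]

lemma exists_pow_of_deriv [Fintype F] {p : ℕ} [Fact p.Prime] [CharP F p] {f : F[X]}
    (h : derivative f = 0) : ∃ h : F[X], f = h ^ p := by
  have hp : p ≠ 0 := (Fact.out : p.Prime).ne_zero
  refine ⟨map (frobeniusEquiv F p).symm (contract p f), ?_⟩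
  rw [← polynomial_expand_eq, expand_contract p h hp]

lemma deriv_pow_p {p : ℕ} [CharP F p] (f : F[X]) : derivative (f ^ p) = 0 := by
  rw [derivative_pow]; simp

lemma deriv_pow_pp {p : ℕ} [CharP F p] (f : F[X]) {j : ℕ} (hj : 0 < j) : derivative (f ^ p ^ j) = 0 := by
  obtain ⟨i, rfl⟩ : ∃ i, j = i + 1 := ⟨j - 1, by omega⟩
  rw [pow_succ, pow_mul]; exact deriv_pow_p _

lemma add_pow_pp {p : ℕ} [Fact p.Prime] [CharP F p] (A B : F[X]) (N j : ℕ) :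
    B ^ p ^ j + X ^ p ^ (N + j) * A ^ p ^ j = (B + X ^ p ^ N * A) ^ p ^ j := by
  rw [add_pow_char_pow, mul_pow, ← pow_mul, ← pow_add]

lemma wr_zero {p : ℕ} [CharP F p] {A B T : F[X]} {N : ℕ} (hN : 0 < N)
    (hco : IsCoprime A B) (hdeg : A.natDegree + B.natDegree ≤ T.natDegree)
    (h1 : T ∣ B + X ^ p ^ N * A) (h2 : T ∣ derivative (B + X ^ p ^ N * A)) :
    derivative A = 0 ∧ derivative B = 0 := by
  rw [← hco.wronskian_eq_zero_iff]
  by_contra hne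
  have hd : T ∣ wronskian A B := by
    have h3 : T ∣ A * derivative (B + X ^ p ^ N * A) - derivative A * (B + X ^ p ^ N * A) :=
      dvd_sub (h2.mul_left _) (h1.mul_left _)
    have : A * derivative (B + X ^ p ^ N * A) - derivative A * (B + X ^ p ^ N * A) = wronskian A B := by
      rw [derivative_add, derivative_mul, deriv_pow_pp X hN, wronskian]; ring
    rwa [this] at h3
  have := natDegree_le_of_dvd hd hne
  have := natDegree_wronskian_lt_add hne
  omega

lemma dvd_deriv_of_sq {L f : F[X]} (h : L ^ 2 ∣ f) : L ∣ derivative f := by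
  have := pow_sub_one_dvd_derivative_of_pow_dvd h
  simpa using this

lemma powlem [Fintype F] {p : ℕ} [Fact p.Prime] [CharP F p] {L : F[X]} {w : ℕ} (hw : 0 < w) (N : ℕ) :
    ∀ j (A B : F[X]), IsCoprime A B → A.natDegree + B.natDegree ≤ L.natDegree →
    L ^ (p ^ j * w) ∣ B + X ^ p ^ (N + j) * A →
    ∃ A' B', A = A' ^ p ^ j ∧ B = B' ^ p ^ j ∧ L ^ w ∣ B' + X ^ p ^ N * A' := by
  have hp : p.Prime := Fact.out
  intro j
  induction j with
  | zero => intro A B _ _ h; exact ⟨A, B, by simp, by simp, by simpa using h⟩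
  | succ j ih =>
    intro A B hco hdeg h
    have h2 : L ^ 2 ∣ B + X ^ p ^ (N + (j+1)) * A := by
      refine (pow_dvd_pow _ ?_).trans h
      have := hp.two_le
      have : 1 ≤ p ^ j := Nat.one_le_pow _ _ hp.pos
      calc 2 ≤ p := hp.two_le
        _ = 1 * p * 1 := by ring
        _ ≤ p ^ (j+1) * w := by rw [pow_succ]; gcongr; omega
    obtain ⟨hA, hB⟩ := wr_zero (by omega) hco hdeg ((dvd_pow_self L two_ne_zero).trans h2) (dvd_deriv_of_sq h2)
    obtain ⟨A1, rfl⟩ := exists_pow_of_deriv (p := p) hA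
    obtain ⟨B1, rfl⟩ := exists_pow_of_deriv (p := p) hB
    have hpp := hp.pos
    rw [IsCoprime.pow_iff hpp hpp] at hco
    obtain ⟨A', B', rfl, rfl, h'⟩ := ih A1 B1 hco (by
      rw [natDegree_pow, natDegree_pow] at hdeg
      have := hp.one_le
      nlinarith) (by
      apply dvd_of_pow_dvd hpp.ne'
      have e := add_pow_pp (p := p) A1 B1 (N + j) 1
      simp only [pow_one] at e
      rw [← e, ← pow_mul]
      rw [pow_succ, mul_right_comm] at h
      exact h)
    exact ⟨A', B', by rw [← pow_mul, pow_succ], by rw [← pow_mul, pow_succ], h'⟩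

lemma rootMult_pow {f : F[X]} (hf : f ≠ 0) (a : F) (k : ℕ) :
    (f ^ k).rootMultiplicity a = k * f.rootMultiplicity a := by
  induction k with
  | zero => 
    rw [pow_zero, zero_mul, rootMultiplicity_eq_zero]; simp
  | succ k ih => rw [pow_succ, rootMultiplicity_mul (mul_ne_zero (pow_ne_zero _ hf) hf), ih]; ring

lemma rootMult_le {L f : F[X]} (hf : f ≠ 0) {a : F} {w : ℕ} (hL : L.eval a = 0) (h : L ^ w ∣ f) :
    w ≤ f.rootMultiplicity a := by
  rw [le_rootMultiplicity_iff hf]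
  exact (pow_dvd_pow_of_dvd (dvd_iff_isRoot.mpr hL) w).trans h

/-- Step 3. -/
lemma step3 {q : ℕ} {L D g W V1 : F[X]} {a0 : F} {ρ s : ℕ}
    (hLD : L * D = X ^ q - X) (hWL : W.comp g = - C a0 * D * derivative L)
    (hW2 : W = C a0 + X ^ ρ * V1 ^ s) :
    C a0 * ((L - X * derivative L) + X ^ q * derivative L) = - L * g ^ ρ * (V1.comp g) ^ s := by
  have h2 : W.comp g = C a0 + g ^ ρ * (V1.comp g) ^ s := by rw [hW2]; simp
  rw [h2] at hWL
  linear_combination L * hWL - C a0 * derivative L * hLD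

set_option maxHeartbeats 1000000 in
lemma step4 [Fintype F] {p : ℕ} [Fact p.Prime] [CharP F p] {n : ℕ} (hn : 0 < n)
    {L D g V1 : F[X]} {a0 : F} {ρ v r κ μ : ℕ} {α : F} (ha0 : a0 ≠ 0)
    (hLD : L * D = X ^ (p ^ n) - X) (hL2 : derivative (derivative L) = 0)
    (hg : 0 < g.natDegree) (hLg : L ∣ g) (hLpos : 0 < L.natDegree) (hLα : L.eval α = 0)
    (hμ : L ^ μ ∣ g) (hμ' : g.rootMultiplicity α = μ) (hd : r * g.natDegree < p ^ n)
    (hV0 : V1.eval 0 ≠ 0) (hρ : 0 < ρ) (hρr : ρ ≤ r) (hvρ : v * ρ + 1 = p ^ κ) (hv : 0 < v)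
    (hκn : κ ≤ n)
    (hC : C a0 * ((L - X * derivative L) + X ^ (p ^ n) * derivative L)
      = - L * g ^ ρ * (V1.comp g) ^ (p ^ κ))
    (hcase : (ρ < r ∧ r = ρ + p ^ κ * V1.natDegree) ∨ (∀ j, 0 < j → ρ ∣ p ^ j - 1 → κ ≤ j)) :
    IsCoprime (derivative L) (L - X * derivative L) ∧ L ^ v ∣ g ∧ ∃ A' B' : F[X], derivative L = A' ^ p ^ κ ∧ L - X * derivative L = B' ^ p ^ κ := by
  have hp : p.Prime := Fact.out
  have hpp := hp.pos
  have hg0 : g ≠ 0 := by rintro rfl; simp at hg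
  have hL0 : L ≠ 0 := by rintro rfl; simp at hLpos
  have hdLD : derivative L * D + L * derivative D = -1 := by
    rw [← derivative_mul, hLD]
    simp [derivative_X_pow, hn.ne']
  have hLle : L.natDegree ≤ g.natDegree := natDegree_le_of_dvd hLg hg0
  have hgα : g.eval α = 0 := by
    obtain ⟨h, rfl⟩ := hLg; simp [hLα]
  set A := derivative L with hA
  set B := L - X * A with hB
  have hcoLA : IsCoprime A L := ⟨-D, -derivative D, by linear_combination -hdLD⟩
  have hco : IsCoprime A B := by
    have : IsCoprime A (L + A * (-X)) := hcoLA.add_mul_left_right (-X)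
    rw [hB]; convert this using 1; ring
  have hA' : derivative A = 0 := hL2
  have hB' : derivative B = 0 := by
    rw [hB, derivative_sub, derivative_mul, hA', derivative_X, ← hA]; ring
  have hAd : A.natDegree < L.natDegree := natDegree_derivative_lt hLpos.ne'
  have hBd : B.natDegree ≤ L.natDegree := by
    apply (natDegree_sub_le _ _).trans
    apply max_le le_rfl
    apply natDegree_mul_le.trans
    rw [natDegree_X]; omega
  have hVα : (V1.comp g).eval α ≠ 0 := by rw [eval_comp, hgα]; exact hV0
  have hV10 : V1.comp g ≠ 0 := by intro h; rw [h] at hVα; simp at hVα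
  have hCa : C a0 ≠ 0 := C_ne_zero.mpr ha0
  -- the polynomial CC
  set CC := B + X ^ (p ^ n) * A with hCC
  have hCC0 : CC ≠ 0 := by
    intro h
    rw [h, mul_zero] at hC
    exact (mul_ne_zero (mul_ne_zero (neg_ne_zero.mpr hL0) (pow_ne_zero _ hg0)) (pow_ne_zero _ hV10)) hC.symm
  have hLsimple : L.rootMultiplicity α = 1 := by
    have h1 : 0 < L.rootMultiplicity α := (rootMultiplicity_pos hL0).mpr hLα
    have h2 : ¬ 1 < L.rootMultiplicity α := by
      rw [one_lt_rootMultiplicity_iff_isRoot hL0]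
      rintro ⟨-, h⟩
      have := congrArg (eval α) hdLD
      rw [← hA] at h
      simp [hLα, h.eq_zero] at this
    omega
  have hmult : CC.rootMultiplicity α = 1 + ρ * μ := by
    have e := congrArg (rootMultiplicity α) hC
    have hne : L * g ^ ρ * (V1.comp g) ^ (p ^ κ) ≠ 0 :=
      (mul_ne_zero (mul_ne_zero hL0 (pow_ne_zero _ hg0)) (pow_ne_zero _ hV10))
    have hrw : - L * g ^ ρ * (V1.comp g) ^ (p ^ κ) = C (-1) * (L * g ^ ρ * (V1.comp g) ^ (p ^ κ)) := by
      simp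
    have hz : (V1.comp g).rootMultiplicity α = 0 := rootMultiplicity_eq_zero hVα
    rw [hrw, rootMultiplicity_mul (mul_ne_zero hCa hCC0), rootMultiplicity_mul
      (mul_ne_zero (C_ne_zero.mpr (by simp)) hne), rootMultiplicity_mul hne, rootMultiplicity_mul
      (mul_ne_zero hL0 (pow_ne_zero _ hg0)), rootMult_pow hg0, rootMult_pow hV10, hz, hμ', hLsimple,
      rootMultiplicity_C, rootMultiplicity_C] at e
    omega
  have hLτ : L ^ (1 + ρ * μ) ∣ CC := by
    have h1 : L ^ (1 + ρ * μ) ∣ C a0 * CC := by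
      rw [hC, pow_add, pow_one, mul_comm ρ μ, pow_mul, neg_mul, neg_mul, dvd_neg]
      apply Dvd.dvd.mul_right
      exact mul_dvd_mul_left _ (pow_dvd_pow_of_dvd hμ _)
    exact (dvd_C_mul ha0).mp h1
  obtain ⟨A1, hA1⟩ := exists_pow_of_deriv (p := p) hA'
  obtain ⟨B1, hB1⟩ := exists_pow_of_deriv (p := p) hB'
  obtain ⟨n', rfl⟩ : ∃ n', n = n' + 1 := ⟨n - 1, by omega⟩
  have hCC1 : CC = (B1 + X ^ p ^ n' * A1) ^ p := by
    have e := add_pow_pp (p := p) A1 B1 n' 1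
    simp only [pow_one] at e
    rw [← e, ← hA1, ← hB1]
  set C1 := B1 + X ^ p ^ n' * A1 with hC1
  have hC10 : C1 ≠ 0 := by intro h; rw [h, zero_pow hpp.ne'] at hCC1; exact hCC0 hCC1
  set τ := C1.rootMultiplicity α with hτ
  have hτ1 : 1 + ρ * μ = p * τ := by rw [← hmult, hCC1, rootMult_pow hC10]
  have hτ0 : τ ≠ 0 := by intro h; rw [h] at hτ1; omega
  have hτle : τ ≤ p ^ n' := by
    have h1 : μ ≤ g.natDegree := by
      have := natDegree_le_of_dvd hμ hg0
      rw [natDegree_pow] at this; nlinarith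
    have h2 : p * τ ≤ p * p ^ n' := by
      rw [← hτ1, ← pow_succ']
      have : ρ * μ ≤ r * g.natDegree := Nat.mul_le_mul hρr h1
      omega
    exact Nat.le_of_mul_le_mul_left h2 hpp
  obtain ⟨i, w, hw, hiw⟩ := Nat.exists_eq_pow_mul_and_not_dvd hτ0 p hp.ne_one
  have hw0 : 0 < w := by
    rcases Nat.eq_zero_or_pos w with h | h
    · rw [h] at hw; simp at hw
    · exact h
  have hi : i ≤ n' := by
    have : p ^ i ≤ p ^ n' := le_trans (by rw [hiw]; exact Nat.le_mul_of_pos_right _ hw0) hτle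
    exact (Nat.pow_le_pow_iff_right hp.one_lt).mp this
  obtain ⟨N, rfl⟩ : ∃ N, n' = N + i := ⟨n' - i, by omega⟩
  have hco1 : IsCoprime A1 B1 := by
    rw [hA1, hB1, IsCoprime.pow_iff hpp hpp] at hco; exact hco
  have hAB : p * (A1.natDegree + B1.natDegree) = A.natDegree + B.natDegree := by
    rw [hA1, hB1, natDegree_pow, natDegree_pow]; ring
  have hL1 : L ^ (p ^ i * w) ∣ C1 := by
    apply dvd_of_pow_dvd hpp.ne'
    rw [← pow_mul, ← hCC1, ← hiw, mul_comm, ← hτ1]; exact hLτ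
  have h2p := hp.two_le
  obtain ⟨Ai, Bi, hAi, hBi, hLi⟩ := powlem hw0 N i A1 B1 hco1 (by nlinarith) hL1
  set Ci := Bi + X ^ p ^ N * Ai with hCi
  have hC1i : C1 = Ci ^ p ^ i := by rw [hC1, hAi, hBi, add_pow_pp]
  have hpi : 0 < p ^ i := pow_pos hpp _
  have hCi0 : Ci ≠ 0 := by intro h; rw [h, zero_pow hpi.ne'] at hC1i; exact hC10 hC1i
  have hwi : Ci.rootMultiplicity α = w := by
    have : τ = p ^ i * Ci.rootMultiplicity α := by rw [hτ, hC1i, rootMult_pow hCi0]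
    rw [hiw] at this
    exact (Nat.eq_of_mul_eq_mul_left hpi this).symm
  have hcoi : IsCoprime Ai Bi := by
    rw [hAi, hBi, IsCoprime.pow_iff hpi hpi] at hco1; exact hco1
  have hABi : p ^ (i+1) * (Ai.natDegree + Bi.natDegree) = A.natDegree + B.natDegree := by
    rw [← hAB, hAi, hBi, natDegree_pow, natDegree_pow]; ring
  have hdegi : Ai.natDegree + Bi.natDegree ≤ L.natDegree := by
    have : p * 1 ≤ p ^ (i+1) := by rw [pow_succ']; exact Nat.mul_le_mul_left _ hpi
    have h3 : 2 * (Ai.natDegree + Bi.natDegree) ≤ p ^ (i+1) * (Ai.natDegree + Bi.natDegree) :=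
      Nat.mul_le_mul_right _ (by omega)
    omega
  have hw1 : w = 1 := by
    by_contra hw1
    have hN : 0 < N := by
      by_contra hN
      have : N = 0 := by omega
      subst this
      rw [zero_add] at hτle
      rw [hiw] at hτle
      have : p ^ i * 2 ≤ p ^ i * w := Nat.mul_le_mul_left _ (by omega)
      omega
    have hLi2 : L ^ 2 ∣ Ci := (pow_dvd_pow _ (by omega)).trans hLi
    obtain ⟨hda, hdb⟩ := wr_zero hN hcoi hdegi ((dvd_pow_self L two_ne_zero).trans hLi2) (dvd_deriv_of_sq hLi2)
    have : derivative Ci = 0 := by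
      rw [hCi, derivative_add, derivative_mul, deriv_pow_pp X hN, hda, hdb]; simp
    obtain ⟨T, hT⟩ := exists_pow_of_deriv (p := p) this
    have hT0 : T ≠ 0 := by rintro rfl; rw [zero_pow hpp.ne'] at hT; exact hCi0 hT
    rw [hT, rootMult_pow hT0] at hwi
    exact hw ⟨_, hwi.symm⟩
  subst hw1
  have hj : 1 + ρ * μ = p ^ (i + 1) := by rw [hτ1, hiw]; ring
  have hκ : κ ≤ i + 1 := by
    rcases hcase with ⟨hlt, hrρ⟩ | h
    · by_contra hcon
      push Not at hcon
      obtain ⟨s, rfl⟩ : ∃ s, κ = (s + 1) + (i + 1) := ⟨κ - (i+1) - 1, by omega⟩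
      have hN : 0 < N := by omega
      set Vj := (V1.comp g) ^ p ^ (s+1) with hVj
      have hVd : Vj ∣ Ci := by
        apply dvd_of_pow_dvd (pow_ne_zero (i+1) hpp.ne')
        have e1 : Ci ^ p ^ (i+1) = CC := by rw [hCC1, hC1i, ← pow_mul, ← pow_succ]
        have e2 : Vj ^ p ^ (i+1) = (V1.comp g) ^ p ^ (s + 1 + (i + 1)) := by
          rw [hVj, ← pow_mul, ← pow_add]
        rw [e1, e2]
        apply (dvd_C_mul ha0).mp
        rw [hC]; exact Dvd.intro_left _ rfl
      have hVd' : Vj ∣ derivative Ci := by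
        obtain ⟨E, hE⟩ := hVd
        rw [hE, derivative_mul, hVj, deriv_pow_pp _ (Nat.succ_pos s)]
        simp
      have hVdeg : p ^ (i+1) * Vj.natDegree = g.natDegree * (r - ρ) := by
        rw [hVj, natDegree_pow, natDegree_comp]
        have : r - ρ = p ^ (s + 1 + (i + 1)) * V1.natDegree := by omega
        rw [this, pow_add]; ring
      have hr2 : 2 ≤ r - ρ := by
        have h1 : r - ρ = p ^ (s + 1 + (i + 1)) * V1.natDegree := by omega
        have h3 : 0 < V1.natDegree := by
          rcases Nat.eq_zero_or_pos V1.natDegree with h | h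
          · rw [h] at h1; omega
          · exact h
        rw [h1, ← hvρ]
        have : 1 ≤ v * ρ := Nat.mul_pos hv hρ
        nlinarith
      obtain ⟨hda, hdb⟩ := wr_zero hN hcoi (by
        have : p ^ (i+1) * (Ai.natDegree + Bi.natDegree) ≤ p ^ (i+1) * Vj.natDegree := by
          rw [hABi, hVdeg]; nlinarith
        exact Nat.le_of_mul_le_mul_left this (pow_pos hpp _)) hVd hVd'
      have hz : derivative Ci = 0 := by
        rw [hCi, derivative_add, derivative_mul, deriv_pow_pp X hN, hda, hdb]; simp
      have : 1 < Ci.rootMultiplicity α := by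
        rw [one_lt_rootMultiplicity_iff_isRoot hCi0]
        refine ⟨(rootMultiplicity_pos hCi0).mp (by omega), by rw [hz]; simp⟩
      omega
    · exact h (i+1) (Nat.succ_pos _) ⟨μ, by omega⟩
  refine ⟨hco, ?_, ?_⟩
  · refine (pow_dvd_pow _ ?_).trans hμ
    have h1 : p ^ κ ≤ p ^ (i+1) := Nat.pow_le_pow_right hpp hκ
    rw [← hj, ← hvρ] at h1
    have : ρ * v ≤ ρ * μ := by rw [mul_comm ρ v]; omega
    exact Nat.le_of_mul_le_mul_left this hρ
  · obtain ⟨s, hs⟩ := Nat.exists_eq_add_of_le hκ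
    refine ⟨Ai ^ p ^ s, Bi ^ p ^ s, ?_, ?_⟩
    · rw [hA1, hAi, ← pow_mul, ← pow_mul, ← pow_succ, hs, ← pow_add, add_comm]
    · rw [hB1, hBi, ← pow_mul, ← pow_mul, ← pow_succ, hs, ← pow_add, add_comm]

end MV


namespace MV
variable {F : Type*} [Field F]

lemma eq_of_pow_pp {p : ℕ} [Fact p.Prime] [CharP F p] {a b : F[X]} (j : ℕ) (h : a ^ p ^ j = b ^ p ^ j) : a = b := by
  rw [← sub_eq_zero] at h ⊢
  rw [← sub_pow_char_pow] at h
  exact pow_eq_zero_iff (pow_ne_zero _ (Fact.out : p.Prime).ne_zero) |>.mp h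

lemma exists_root_pp [Fintype F] {p : ℕ} [Fact p.Prime] [CharP F p] (c : F) (j : ℕ) : ∃ d : F, d ^ p ^ j = c := by
  obtain ⟨d, hd⟩ := (iterateFrobeniusEquiv F p j).surjective c
  exact ⟨d, by rw [← hd]; exact (iterateFrobenius_def (R := F) p j d).symm⟩

lemma assoc_C {a b : F[X]} (h : Associated a b) : ∃ c : F, c ≠ 0 ∧ b = C c * a := by
  obtain ⟨u, hu⟩ := h
  obtain ⟨c, hc, hcu⟩ := Polynomial.isUnit_iff.mp u.isUnit
  exact ⟨c, hc.ne_zero, by rw [← hu, ← hcu]; ring⟩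

lemma expandE (q : ℕ) (hq : 1 ≤ q) : ∀ v : ℕ, ∃ E : F[X], (X ^ q - X) ^ (v+1) = X ^ (q * (v+1)) + E ∧ E.natDegree ≤ q * v + 1 := by
  intro v
  induction v with
  | zero => exact ⟨-X, by simp; ring, by simp⟩
  | succ v ih =>
    obtain ⟨E, hE, hd⟩ := ih
    refine ⟨(X ^ q - X) * E - X * X ^ (q * (v+1)), ?_, ?_⟩
    · rw [pow_succ, hE]; ring
    · apply (natDegree_sub_le _ _).trans
      apply max_le
      · apply natDegree_mul_le.trans
        have : (X ^ q - X : F[X]).natDegree ≤ q := by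
          apply (natDegree_sub_le _ _).trans
          simp [hq]
        nlinarith
      · rw [← pow_succ', natDegree_X_pow]

lemma step5 {p : ℕ} [Fact p.Prime] [CharP F p] {n : ℕ}
    {L D g W V1 : F[X]} {a0 : F} {ρ s v r K : ℕ} (ha0 : a0 ≠ 0) (hr : 2 ≤ r)
    (hLm : L.Monic)
    (hLD : L * D = X ^ (p ^ n) - X) (hWL : W.comp g = - C a0 * D * derivative L)
    (hW2 : W = C a0 + X ^ ρ * V1 ^ s) (hρ : 0 < ρ)
    (hWm : W.Monic) (hWd : W.natDegree = r) (hvr : v * r + 1 = p ^ K) (hv : 0 < v) (hKn : K ≤ n)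
    (hg : 0 < g.natDegree) (hLpos : 0 < L.natDegree)
    (hd : r * g.natDegree < p ^ n) (hLv : L ^ v ∣ g) :
    ∃ (N P : F[X]) (c c' : F), c ≠ 0 ∧ c' ≠ 0 ∧ N ≠ 0 ∧ g = C c * (L ^ v * N ^ p ^ K) ∧
      derivative L ≠ 0 ∧
      derivative L ^ v = C c' * P ^ p ^ K := by
  have hp : p.Prime := Fact.out
  have hpp := hp.pos
  have hg0 : g ≠ 0 := by rintro rfl; simp at hg
  set A := derivative L with hA
  have h2 : W.comp g = C a0 + g ^ ρ * (V1.comp g) ^ s := by rw [hW2]; simp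
  have hcoAg : IsCoprime A g := by
    obtain ⟨ρ', rfl⟩ : ∃ i, ρ = i + 1 := ⟨ρ - 1, by omega⟩
    refine ⟨- D, - C (a0⁻¹) * g ^ ρ' * (V1.comp g) ^ s, ?_⟩
    have hc : C (a0⁻¹) * C a0 = (1 : F[X]) := by rw [← C_mul, inv_mul_cancel₀ ha0, C_1]
    linear_combination - C (a0⁻¹) * hWL + C (a0⁻¹) * h2 + (1 + A * D) * hc
  obtain ⟨G, hG⟩ := hLv
  have hG0 : G ≠ 0 := by rintro rfl; rw [mul_zero] at hG; exact hg0 hG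
  have hAd : A.natDegree < L.natDegree := natDegree_derivative_lt hLpos.ne'
  have hA0 : A ≠ 0 := by
    intro h; rw [h, mul_zero] at hWL
    have : (W.comp g).natDegree = r * g.natDegree := by rw [natDegree_comp, hWd]
    rw [hWL, natDegree_zero] at this
    have : 0 < r * g.natDegree := by positivity
    omega
  set M := p ^ K with hM
  set q := p ^ n with hq
  obtain ⟨Y, hY⟩ : ∃ Y, q = M * Y := pow_dvd_pow p hKn
  have hM0 : 0 < M := pow_pos hpp _
  have hq0 : 0 < q := pow_pos hpp _
  have hY0 : 0 < Y := by
    rcases Nat.eq_zero_or_pos Y with h | h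
    · rw [h] at hY; omega
    · exact h
  obtain ⟨v', rfl⟩ : ∃ v', v = v' + 1 := ⟨v - 1, by omega⟩
  set R := A ^ (v'+1) * G with hR
  have hid : g * (W.comp g) ^ (v'+1) = C ((-a0) ^ (v'+1)) * (X ^ q - X) ^ (v'+1) * R := by
    rw [hWL, ← hLD, hR]; nth_rewrite 1 [hG]
    simp only [mul_pow, C_pow, C_neg]
    ring
  obtain ⟨E, hE, hEd⟩ := expandE (F := F) q hq0 v'
  have hgd : g.natDegree = (v'+1) * L.natDegree + G.natDegree := by
    rw [hG, natDegree_mul (pow_ne_zero _ hLm.ne_zero) hG0, natDegree_pow]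
  have hRd : R.natDegree < g.natDegree := by
    rw [hR, natDegree_mul (pow_ne_zero _ hA0) hG0, natDegree_pow, hgd]
    have : (v'+1) * A.natDegree < (v'+1) * L.natDegree := Nat.mul_lt_mul_of_pos_left hAd (by omega)
    omega
  -- top part
  set T := X * W ^ (v'+1) - X ^ M with hT
  have hTd : T.natDegree ≤ (v'+1) * r := by
    have hm : (X * W ^ (v'+1)).Monic := monic_X.mul (hWm.pow _)
    have hnd : (X * W ^ (v'+1)).natDegree = M := by
      rw [natDegree_mul X_ne_zero (pow_ne_zero _ hWm.ne_zero), natDegree_X, natDegree_pow, hWd]; omega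
    have : T.degree < (X * W ^ (v'+1)).degree := by
      apply degree_sub_lt
      · rw [degree_X_pow, degree_eq_natDegree hm.ne_zero, hnd]
      · exact hm.ne_zero
      · rw [hm.leadingCoeff, leadingCoeff_X_pow]
    by_cases hT0 : T = 0
    · rw [hT0]; simp
    · have := natDegree_lt_natDegree hT0 this
      omega
  have hTc : g * (W.comp g) ^ (v'+1) = g ^ M + T.comp g := by
    rw [hT]; simp
  have hTcd : (T.comp g).natDegree < q * (v'+1) := by
    rw [natDegree_comp]
    calc T.natDegree * g.natDegree ≤ (v'+1) * r * g.natDegree := Nat.mul_le_mul_right _ hTd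
      _ = (v'+1) * (r * g.natDegree) := by ring
      _ < (v'+1) * q := Nat.mul_lt_mul_of_pos_left hd (by omega)
      _ = _ := by ring
  have hXm : (X ^ (Y * (v'+1)) : F[X]).Monic := monic_X_pow _
  have hYv : 0 < Y * (v'+1) := by positivity
  set g1 := g /ₘ X ^ (Y * (v'+1)) with hg1
  set g0 := g %ₘ X ^ (Y * (v'+1)) with hg0'
  have hgg : g0 + X ^ (Y * (v'+1)) * g1 = g := modByMonic_add_div _ _
  have hg0d : g0.natDegree < Y * (v'+1) := by
    have := natDegree_modByMonic_lt g hXm (by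
      intro h; have := congrArg natDegree h; rw [natDegree_X_pow, natDegree_one] at this; omega)
    rwa [natDegree_X_pow] at this
  have hgM : g ^ M = g0 ^ M + X ^ (q * (v'+1)) * g1 ^ M := by
    rw [← hgg, hM, add_pow_char_pow, mul_pow, ← pow_mul, hY]; congr 3; ring
  have hcoef : X ^ (q * (v'+1)) * (g1 ^ M - C ((-a0) ^ (v'+1)) * R) =
      C ((-a0) ^ (v'+1)) * (E * R) - g0 ^ M - T.comp g := by
    rw [hTc, hE, hgM] at hid
    linear_combination hid
  have hg1M : g1 ^ M = C ((-a0) ^ (v'+1)) * R := by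
    rw [← sub_eq_zero]; by_contra hne
    have e := congrArg natDegree hcoef
    rw [natDegree_mul (pow_ne_zero _ X_ne_zero) hne, natDegree_X_pow] at e
    have h1 : (C ((-a0) ^ (v'+1)) * (E * R) - g0 ^ M - T.comp g).natDegree < q * (v'+1) := by
      apply lt_of_le_of_lt (natDegree_sub_le _ _)
      apply max_lt _ hTcd
      apply lt_of_le_of_lt (natDegree_sub_le _ _)
      apply max_lt
      · apply lt_of_le_of_lt (natDegree_C_mul_le _ _)
        apply lt_of_le_of_lt natDegree_mul_le
        have : 2 * g.natDegree ≤ r * g.natDegree := Nat.mul_le_mul_right _ hr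
        nlinarith
      · rw [natDegree_pow, hY]
        calc M * g0.natDegree < M * (Y * (v'+1)) := Nat.mul_lt_mul_of_pos_left hg0d hM0
          _ = _ := by ring
    omega
  have hu : (-a0) ^ (v'+1) ≠ 0 := pow_ne_zero _ (neg_ne_zero.mpr ha0)
  have hcoAG : IsCoprime A G := hcoAg.of_isCoprime_of_dvd_right (by rw [hG]; exact Dvd.intro_left _ rfl)
  have hcoab : IsCoprime (C ((-a0) ^ (v'+1)) * A ^ (v'+1)) G := by
    rw [isCoprime_mul_unit_left_left (isUnit_C.mpr hu.isUnit)]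
    exact hcoAG.pow_left
  have hab : (C ((-a0) ^ (v'+1)) * A ^ (v'+1)) * G = g1 ^ M := by rw [hg1M, hR]; ring
  obtain ⟨P, hP⟩ := exists_associated_pow_of_mul_eq_pow' hcoab hab
  obtain ⟨N, hN⟩ := exists_associated_pow_of_mul_eq_pow' hcoab.symm (by rw [mul_comm]; exact hab)
  obtain ⟨c1, hc1, hP'⟩ := assoc_C hP
  obtain ⟨c2, hc2, hN'⟩ := assoc_C hN
  refine ⟨N, P, c2, ((-a0) ^ (v'+1))⁻¹ * c1, hc2, mul_ne_zero (inv_ne_zero hu) hc1, ?_, ?_, hA0, ?_⟩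
  · rintro rfl; rw [zero_pow hM0.ne', mul_zero] at hN'; exact hG0 hN'
  · rw [hG, hN']; ring
  · rw [C_mul, mul_assoc, ← hP', ← mul_assoc, ← C_mul, inv_mul_cancel₀ hu]; simp

end MV


namespace MV
variable {F : Type*} [Field F]

lemma root_eq [Fintype F] {p : ℕ} [Fact p.Prime] [CharP F p] {n' κ κ' v ρ : ℕ}
    {L g V1 A B N Ak Bk : F[X]} {a0 c : F} (ha0 : a0 ≠ 0) (hc : c ≠ 0)
    (hA : A = Ak ^ p ^ κ) (hB : B = Bk ^ p ^ κ)
    (hC : C a0 * (B + X ^ (p ^ (n' + κ)) * A) = - L * g ^ ρ * (V1.comp g) ^ (p ^ κ))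
    (hg : g = C c * (L ^ v * N ^ p ^ (κ' + κ))) (hvρ : v * ρ + 1 = p ^ κ) :
    ∃ c0 : F, c0 ≠ 0 ∧ Bk + X ^ p ^ n' * Ak = C c0 * (L * N ^ (p ^ κ' * ρ) * V1.comp g) := by
  obtain ⟨c0, hc0⟩ := exists_root_pp (p := p) (- c ^ ρ * a0⁻¹) κ
  have hne : - c ^ ρ * a0⁻¹ ≠ 0 := mul_ne_zero (neg_ne_zero.mpr (pow_ne_zero _ hc)) (inv_ne_zero ha0)
  refine ⟨c0, ?_, ?_⟩
  · rintro rfl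
    rw [zero_pow (pow_ne_zero _ (Fact.out : p.Prime).ne_zero)] at hc0
    exact hne hc0.symm
  · apply eq_of_pow_pp (p := p) κ
    rw [← add_pow_pp, ← hA, ← hB]
    apply mul_left_cancel₀ (C_ne_zero.mpr ha0)
    rw [hC, mul_pow, ← C_pow, hc0]
    have hcc : C a0 * C (a0⁻¹) = (1 : F[X]) := by rw [← C_mul, mul_inv_cancel₀ ha0, C_1]
    have e1 : L * g ^ ρ = C (c ^ ρ) * (L * N ^ (p ^ κ' * ρ)) ^ p ^ κ := by
      rw [hg, mul_pow, mul_pow, mul_pow, ← hvρ, ← pow_mul, ← pow_mul, ← pow_mul, pow_succ L, C_pow, hvρ,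
        pow_add]
      have : p ^ κ' * p ^ κ * ρ = p ^ κ' * ρ * p ^ κ := by ring
      rw [this]; ring
    rw [mul_pow (L * N ^ (p ^ κ' * ρ))]
    simp only [C_mul, C_neg]
    linear_combination (-(V1.comp g) ^ p ^ κ) * e1 + (C (c ^ ρ) * (L * N ^ (p ^ κ' * ρ)) ^ p ^ κ * (V1.comp g) ^ p ^ κ) * hcc

lemma deg_eq {q : ℕ} (hq : 1 < q) {L D g W N : F[X]} {a0 c : F} {v r M : ℕ} (ha0 : a0 ≠ 0)
    (hc : c ≠ 0) (hN : N ≠ 0)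
    (hLm : L.Monic) (hA0 : derivative L ≠ 0)
    (hLD : L * D = X ^ q - X) (hWL : W.comp g = - C a0 * D * derivative L)
    (hWd : W.natDegree = r) (hvr : v * r + 1 = M) 
    (hg : g = C c * (L ^ v * N ^ M)) :
    M * L.natDegree + r * M * N.natDegree = q + (derivative L).natDegree := by
  have h1 : (W.comp g).natDegree = r * g.natDegree := by rw [natDegree_comp, hWd]
  have hD0 : D ≠ 0 := by
    rintro rfl; rw [mul_zero] at hLD
    exact FiniteField.X_pow_card_sub_X_ne_zero F hq hLD.symm
  have h2 := congrArg natDegree hLD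
  rw [natDegree_mul hLm.ne_zero hD0, FiniteField.X_pow_card_sub_X_natDegree_eq F hq] at h2
  have h3 : g.natDegree = v * L.natDegree + M * N.natDegree := by
    rw [hg, natDegree_C_mul hc, natDegree_mul (pow_ne_zero _ hLm.ne_zero) (pow_ne_zero _ hN), natDegree_pow, natDegree_pow]
  have h4 : (- C a0 * D * derivative L).natDegree = D.natDegree + (derivative L).natDegree := by
    rw [← C_neg, mul_assoc, natDegree_C_mul (neg_ne_zero.mpr ha0), natDegree_mul hD0 hA0]
  rw [hWL, h4, h3] at h1
  rw [← hvr] at *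
  linear_combination h2 - h1

lemma step6 [Fintype F] {p : ℕ} [Fact p.Prime] [CharP F p] {n K κ v ρ r : ℕ}
    {L g V1 N Ak Bk P : F[X]} {a0 b0 c c' : F} (ha0 : a0 ≠ 0) (hc : c ≠ 0) (hc' : c' ≠ 0) (hN0 : N ≠ 0)
    (hA : derivative L = Ak ^ p ^ κ) (hB : L - X * derivative L = Bk ^ p ^ κ)
    (hA0 : derivative L ≠ 0) (hL0 : L ≠ 0)
    (hC : C a0 * ((L - X * derivative L) + X ^ (p ^ n) * derivative L) = - L * g ^ ρ * (V1.comp g) ^ (p ^ κ))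
    (hg : g = C c * (L ^ v * N ^ p ^ K)) (hvρ : v * ρ + 1 = p ^ κ) (hv : 0 < v) (hρ : 0 < ρ)
    (hP : derivative L ^ v = C c' * P ^ p ^ K) (hκK : κ < K) (hKn : K ≤ n)
    (hvr : v * r + 1 = p ^ K) (hbig : p ^ n < (p * (r + 1)) ^ 2)
    (hV1 : C (v : F) * X * derivative V1 + V1 = C b0) (hb0 : b0 ≠ 0)
    (hdeg : p ^ K * L.natDegree + r * p ^ K * N.natDegree = p ^ n + (derivative L).natDegree)
    (hν : 0 < N.natDegree) : False := by
  have hp : p.Prime := Fact.out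
  have hpp := hp.pos
  have hκ0 : 0 < κ := by
    rcases Nat.eq_zero_or_pos κ with h | h
    · rw [h, pow_zero] at hvρ; have := Nat.mul_pos hv hρ; omega
    · exact h
  have hvF : (v : F) ≠ 0 := by
    intro h
    have h2 : ((v * ρ + 1 : ℕ) : F) = 0 := by rw [hvρ]; simp [hκ0.ne']
    push_cast at h2; rw [h] at h2; simp at h2
  have hK0 : 0 < K := by omega
  obtain ⟨κ', rfl⟩ : ∃ i, K = i + κ := ⟨K - κ, by omega⟩
  obtain ⟨n', rfl⟩ : ∃ i, n = i + κ := ⟨n - κ, by omega⟩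
  have hκ'0 : 0 < κ' := by omega
  have hn'0 : 0 < n' := by omega
  obtain ⟨c0, hc0, hE⟩ := root_eq (p := p) ha0 hc hA hB hC hg hvρ
  have hpκ : p ^ κ ≠ 0 := pow_ne_zero _ hpp.ne'
  have hAk0 : Ak ≠ 0 := by rintro rfl; rw [zero_pow hpκ] at hA; exact hA0 hA
  -- derivative of Ak
  have hAk' : derivative Ak = 0 := by
    obtain ⟨c2, hc2⟩ := exists_root_pp (p := p) c' κ
    have e : Ak ^ v = C c2 * P ^ p ^ κ' := by
      apply eq_of_pow_pp (p := p) κ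
      rw [mul_pow, ← C_pow, hc2, ← pow_mul, ← pow_mul, ← pow_add, ← hP, hA, ← pow_mul, mul_comm]
    have e2 := congrArg derivative e
    rw [derivative_mul, deriv_pow_pp _ hκ'0, derivative_C, derivative_pow] at e2
    simp only [zero_mul, mul_zero, add_zero] at e2
    rcases mul_eq_zero.mp e2 with h | h
    · rcases mul_eq_zero.mp h with h | h
      · exact absurd h (C_ne_zero.mpr hvF)
      · exact absurd h (pow_ne_zero _ hAk0)
    · exact h
  have hLg : L * derivative g = C (v : F) * g * derivative L := by
    obtain ⟨v', rfl⟩ : ∃ i, v = i + 1 := ⟨v - 1, by omega⟩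
    rw [hg, derivative_mul, derivative_C, derivative_mul, deriv_pow_pp _ hK0, derivative_pow_succ]
    simp; ring
  have hV1c : C (v : F) * g * (derivative V1).comp g + V1.comp g = C b0 := by
    have := congrArg (fun f => f.comp g) hV1
    simpa using this
  have hBk' : derivative Bk = C c0 * C b0 * N ^ (p ^ κ' * ρ) * derivative L := by
    have e := congrArg derivative hE
    have hNN : derivative (N ^ (p ^ κ' * ρ)) = 0 := by
      rw [mul_comm, pow_mul]; exact deriv_pow_pp _ hκ'0
    rw [derivative_add, derivative_mul, deriv_pow_pp _ hn'0, hAk', derivative_mul, derivative_mul, derivative_mul,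
      hNN, derivative_C, derivative_comp] at e
    linear_combination e + C c0 * N ^ (p ^ κ' * ρ) * (derivative V1).comp g * hLg + C c0 * N ^ (p ^ κ' * ρ) * derivative L * hV1c
  have hBkd : (derivative Bk).natDegree = p ^ κ' * ρ * N.natDegree + (derivative L).natDegree := by
    rw [hBk', ← C_mul, mul_assoc, natDegree_C_mul (mul_ne_zero hc0 hb0), natDegree_mul (pow_ne_zero _ hN0) hA0, natDegree_pow]
  have hBk0 : 0 < Bk.natDegree := by
    by_contra h
    have : derivative Bk = 0 := by rw [eq_C_of_natDegree_eq_zero (by omega : Bk.natDegree = 0)]; simp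
    rw [hBk'] at this
    exact (mul_ne_zero (mul_ne_zero (mul_ne_zero (C_ne_zero.mpr hc0) (C_ne_zero.mpr hb0)) (pow_ne_zero _ hN0)) hA0) this
  have hBklt := natDegree_derivative_lt hBk0.ne'
  have hBd : (L - X * derivative L).natDegree = p ^ κ * Bk.natDegree := by rw [hB, natDegree_pow]
  have hBle : (L - X * derivative L).natDegree ≤ L.natDegree := by
    apply (natDegree_sub_le _ _).trans
    apply max_le le_rfl
    apply natDegree_mul_le.trans
    rw [natDegree_X]
    have : 0 < L.natDegree := by
      by_contra h
      rw [eq_C_of_natDegree_eq_zero (by omega : L.natDegree = 0)] at hA0; simp at hA0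
    have := natDegree_derivative_lt this.ne'
    omega
  obtain ⟨a', ha'⟩ : p ^ (κ' + κ) ∣ (derivative L).natDegree := by
    have e := congrArg natDegree hP
    rw [natDegree_C_mul hc', natDegree_pow, natDegree_pow] at e
    have hcop : Nat.Coprime (p ^ (κ' + κ)) v := by
      rw [← hvr]; simp
    exact hcop.dvd_of_dvd_mul_left ⟨_, e⟩
  rw [ha'] at hBkd hdeg
  obtain ⟨y, hy⟩ : ∃ y, n' + κ = y + (κ' + κ) := ⟨n' - κ', by omega⟩
  have hM0 : 0 < p ^ (κ' + κ) := pow_pos hpp _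
  have hMeq : p ^ (κ' + κ) = p ^ κ' * p ^ κ := pow_add _ _ _
  rw [hy] at hdeg hbig
  have hdeg2 : L.natDegree + r * N.natDegree = p ^ y + a' := by
    apply Nat.eq_of_mul_eq_mul_left hM0
    rw [pow_add p y] at hdeg
    linear_combination hdeg
  have hYle : p ^ y ≤ p * p ^ (κ' + κ) := by
    rw [← pow_succ']
    apply Nat.pow_le_pow_right hpp
    have h1 : r + 1 ≤ p ^ (κ' + κ) := by rw [← hvr]; have := Nat.le_mul_of_pos_left r hv; omega
    have h2 : p ^ (y + (κ' + κ)) < p ^ (2 * (κ' + κ + 1)) := by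
      calc _ < _ := hbig
        _ ≤ (p * p ^ (κ' + κ)) ^ 2 := by gcongr
        _ = _ := by ring
    have := (Nat.pow_lt_pow_iff_right hp.one_lt).mp h2
    omega
  have hineq : p ^ κ * (p ^ κ' * ρ * N.natDegree + p ^ (κ' + κ) * a' + 1) ≤ L.natDegree := by
    rw [← hBkd]
    calc _ ≤ p ^ κ * Bk.natDegree := Nat.mul_le_mul_left _ hBklt
      _ ≤ _ := by rw [← hBd]; exact hBle
  set M := p ^ (κ' + κ) with hM
  have hpκ2 : p ≤ p ^ κ := by
    calc p = p ^ 1 := (pow_one p).symm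
      _ ≤ _ := Nat.pow_le_pow_right hpp hκ0
  have h2p := hp.two_le
  have hineq2 : M * (ρ * N.natDegree) + p ^ κ * M * a' + p ^ κ ≤ L.natDegree := by
    have : p ^ κ * (p ^ κ' * ρ * N.natDegree + M * a' + 1) = M * (ρ * N.natDegree) + p ^ κ * M * a' + p ^ κ := by
      rw [hMeq]; ring
    omega
  have ha'0 : a' = 0 := by
    by_contra h
    have h1 : p * M * a' ≤ p ^ κ * M * a' := by gcongr
    have h3 : p * M + a' ≤ p * M * a' + 1 := by
      have : 1 ≤ p * M := Nat.mul_pos hpp hM0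
      obtain ⟨x, hx⟩ := Nat.exists_eq_add_of_le this
      obtain ⟨z, hz⟩ := Nat.exists_eq_add_of_le (Nat.one_le_iff_ne_zero.mpr h)
      rw [hx, hz]; nlinarith
    omega
  subst ha'0
  have hM2 : M * (ρ * N.natDegree) < M * p := by
    rw [mul_comm M p]; omega
  have hνp : N.natDegree < p := lt_of_le_of_lt (Nat.le_mul_of_pos_left _ hρ) (Nat.lt_of_mul_lt_mul_left hM2)
  have hl2 : 2 ≤ L.natDegree := by omega
  have hpl : p ∣ L.natDegree := by
    have : (L - X * derivative L).natDegree = L.natDegree := by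
      apply natDegree_sub_eq_left_of_natDegree_lt
      have : (X * derivative L).natDegree ≤ 1 + 0 := by
        apply natDegree_mul_le.trans
        rw [natDegree_X, ha', mul_zero]
      omega
    rw [← this, hBd]
    exact (dvd_pow_self p hκ0.ne').mul_right _
  have hpY : p ∣ p ^ y := by
    apply dvd_pow_self
    rintro rfl
    rw [pow_zero] at hdeg2
    omega
  have hprν : p ∣ r * N.natDegree := by
    rw [← Nat.dvd_add_right hpl, hdeg2]; simpa using hpY
  rcases hp.dvd_mul.mp hprν with h | h
  · have h1 : p ∣ v * r + 1 := by rw [hvr]; exact dvd_pow_self p hK0.ne'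
    have := (Nat.dvd_add_right (h.mul_left v)).mp h1
    exact hp.one_lt.ne' (Nat.dvd_one.mp this)
  · exact absurd (Nat.le_of_dvd hν h) (by omega)
end MV


namespace MV
variable {F : Type*} [Field F]

lemma mul_deriv_pow (π : F[X]) (t : ℕ) : π * derivative (π ^ t) = C (t : F) * π ^ t * derivative π := by
  cases t with
  | zero => simp
  | succ t => rw [derivative_pow_succ]; push_cast; ring

lemma local_mult [Fintype F] {p : ℕ} [Fact p.Prime] [CharP F p] {v r s : ℕ} (hvr : v * r + 1 = p)
    (hr : 0 < r)
    {N A1 Q π E : F[X]} (hπ : Irreducible π) (hN : N = π ^ s * E) (hE : ¬ π ∣ E) (hA1 : ¬ (0 < s ∧ π ∣ A1))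
    (hQ : Q = C (v : F) * derivative A1 * N + A1 * derivative N)
    (h : N * derivative Q = C ((r : F) + 1) * derivative N * Q) : p ∣ s ∨ s % p = v := by
  by_cases hps : p ∣ s
  · exact Or.inl hps
  right
  have hsF : (s : F) ≠ 0 := by rwa [Ne, CharP.cast_eq_zero_iff F p]
  obtain ⟨t, rfl⟩ : ∃ t, s = t + 1 := ⟨s - 1, by
    have : s ≠ 0 := by rintro rfl; simp at hps
    omega⟩
  have hA : ¬ π ∣ A1 := fun h => hA1 ⟨Nat.succ_pos _, h⟩
  have hpr : Prime π := hπ.prime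
  have hπ' : ¬ π ∣ derivative π := by
    intro hd
    have hs : π.Separable := PerfectField.separable_of_irreducible hπ
    have := hs.isUnit_of_dvd' (dvd_refl _) hd
    exact hπ.not_isUnit this
  set T := C ((t : F) + 1) * derivative π * E + π * derivative E with hT
  set Y := C (v : F) * π * derivative A1 * E + A1 * T with hY
  have hN' : derivative N = π ^ t * T := by
    rw [hN, derivative_mul, derivative_pow_succ, hT]; ring
  have hQY : Q = π ^ t * Y := by
    rw [hQ, hN', hN, hY]; ring
  have hQ' : π * derivative Q = π ^ t * (C (t : F) * derivative π * Y + π * derivative Y) := by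
    rw [hQY, derivative_mul]
    linear_combination Y * mul_deriv_pow π t
  have hπ0 : π ≠ 0 := hπ.ne_zero
  have key : E * (C (t : F) * derivative π * Y + π * derivative Y) = C ((r : F) + 1) * T * Y := by
    apply mul_left_cancel₀ (pow_ne_zero (2 * t + 1) hπ0)
    have e1 : π * (N * derivative Q) = π ^ (2 * t + 1) * (E * (C (t : F) * derivative π * Y + π * derivative Y)) := by
      rw [show π * (N * derivative Q) = N * (π * derivative Q) by ring, hQ', hN]; ring
    rw [← e1, h, hN', hQY]; ring
  have hTd : ¬ π ∣ T := by
    intro hd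
    rw [hT] at hd
    have h2 := (dvd_add_left (dvd_mul_right π (derivative E))).mp hd
    rcases hpr.dvd_or_dvd h2 with h3 | h3
    · rcases hpr.dvd_or_dvd h3 with h4 | h4
      · have : IsUnit (C ((t : F) + 1)) := isUnit_C.mpr (IsUnit.mk0 _ (by exact_mod_cast hsF))
        exact hπ.not_isUnit (isUnit_of_dvd_unit h4 this)
      · exact hπ' h4
    · exact hE h3
  have hYd : ¬ π ∣ Y := by
    intro hd
    have h2 : π ∣ C (v : F) * π * derivative A1 * E := ⟨C (v : F) * derivative A1 * E, by ring⟩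
    rw [hY] at hd
    have h3 := (dvd_add_right h2).mp hd
    rcases hpr.dvd_or_dvd h3 with h4 | h4
    · exact hA h4
    · exact hTd h4
  have hfin : π ∣ C ((r : F) * ((t : F) + 1) + 1) * (E * Y * derivative π) := by
    refine ⟨E * derivative Y - C ((r : F) + 1) * derivative E * Y, ?_⟩
    rw [hT] at key
    simp only [C_add, C_mul, C_1] at key ⊢
    linear_combination -key
  have hz : (r : F) * ((t : F) + 1) + 1 = 0 := by
    by_contra hne
    rcases hpr.dvd_or_dvd hfin with h1 | h1
    · exact hπ.not_isUnit (isUnit_of_dvd_unit h1 (isUnit_C.mpr (IsUnit.mk0 _ hne)))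
    · rcases hpr.dvd_or_dvd h1 with h2 | h2
      · rcases hpr.dvd_or_dvd h2 with h3 | h3
        · exact hE h3
        · exact hYd h3
      · exact hπ' h2
  have hvF : (v : F) * r + 1 = 0 := by
    have : ((v * r + 1 : ℕ) : F) = 0 := by rw [hvr]; simp
    exact_mod_cast this
  have hst : ((t + 1 : ℕ) : F) = (v : F) := by
    push_cast; linear_combination ((t:F)+1) * hvF - v * hz
  have := (CharP.natCast_eq_natCast F p).mp hst
  have hvp : v < p := by rw [← hvr]; nlinarith
  rw [Nat.ModEq, Nat.mod_eq_of_lt hvp] at this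
  exact this

lemma glob_mult {p v : ℕ} (N : F[X]) : N ≠ 0 →
    (∀ (π E : F[X]) (s : ℕ), Irreducible π → N = π ^ s * E → ¬ π ∣ E → p ∣ s ∨ s % p = v) →
    ∃ (u : F) (N1 N2 : F[X]), u ≠ 0 ∧ N = C u * N1 ^ v * N2 ^ p := by
  induction N using UniqueFactorizationMonoid.induction_on_coprime with
  | h0 => intro h; exact absurd rfl h
  | @h1 x hx =>
    intro _ _
    obtain ⟨c, hc, rfl⟩ := Polynomial.isUnit_iff.mp hx
    exact ⟨c, 1, 1, hc.ne_zero, by simp⟩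
  | @hpr π i hπ =>
    intro _ h
    rcases h π 1 i hπ.irreducible (by simp) (fun hd => hπ.not_isUnit (isUnit_of_dvd_one hd)) with ⟨j, hj⟩ | hj
    · exact ⟨1, 1, π ^ j, one_ne_zero, by rw [hj, mul_comm p j, pow_mul]; simp⟩
    · refine ⟨1, π, π ^ (i / p), one_ne_zero, ?_⟩
      rw [← pow_mul, C_1, one_mul, ← pow_add]
      congr 1
      rw [← hj, mul_comm]; exact (Nat.mod_add_div i p).symm
  | @hcp x y hxy hx hy =>
    intro h0 h
    obtain ⟨u1, a1, a2, hu1, e1⟩ := hx (left_ne_zero_of_mul h0) (by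
      intro π E s hπ hE hd
      rcases Nat.eq_zero_or_pos s with hs | hs
      · subst hs; simp
      · apply h π (E * y) s hπ (by rw [hE]; ring)
        intro hd2
        rcases hπ.prime.dvd_or_dvd hd2 with h3 | h3
        · exact hd h3
        · have : π ∣ x := by rw [hE]; exact (dvd_pow_self π hs.ne').mul_right _
          exact hπ.not_isUnit (hxy this h3))
    obtain ⟨u2, b1, b2, hu2, e2⟩ := hy (right_ne_zero_of_mul h0) (by
      intro π E s hπ hE hd
      rcases Nat.eq_zero_or_pos s with hs | hs
      · subst hs; simp
      · apply h π (E * x) s hπ (by rw [hE]; ring)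
        intro hd2
        rcases hπ.prime.dvd_or_dvd hd2 with h3 | h3
        · exact hd h3
        · have : π ∣ y := by rw [hE]; exact (dvd_pow_self π hs.ne').mul_right _
          exact hπ.not_isUnit (hxy h3 this))
    refine ⟨u1 * u2, a1 * b1, a2 * b2, mul_ne_zero hu1 hu2, ?_⟩
    rw [e1, e2, C_mul]; ring
end MV


namespace MV
variable {F : Type*} [Field F]

/-- a divisor of a power of a linear polynomial -/
lemma dvd_lin_pow {f : F[X]} {x ξ : F} {m : ℕ} (hx : x ≠ 0) (h : f ∣ C x * (X - C ξ) ^ m) :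
    ∃ u : F, u ≠ 0 ∧ f = C u * (X - C ξ) ^ f.natDegree := by
  have h2 : f ∣ (X - C ξ) ^ m := (dvd_C_mul hx).mp h
  obtain ⟨i, _, hi⟩ := (dvd_prime_pow (prime_X_sub_C ξ) m).mp h2
  obtain ⟨u, hu, e⟩ := assoc_C hi.symm
  refine ⟨u, hu, ?_⟩
  have : f.natDegree = i := by rw [e, natDegree_C_mul hu, natDegree_pow, natDegree_X_sub_C, mul_one]
  rw [this]; exact e

lemma two_part {f h : F[X]} {Q : ℕ} (hd : f.natDegree < Q) (e : f + X ^ Q * h = 0) : f = 0 ∧ h = 0 := by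
  have hh : h = 0 := by
    by_contra hne
    have e2 : f = - (X ^ Q * h) := by linear_combination e
    rw [e2, natDegree_neg, natDegree_mul (pow_ne_zero _ X_ne_zero) hne, natDegree_X_pow] at hd
    omega
  exact ⟨by rw [hh] at e; simpa using e, hh⟩

set_option maxHeartbeats 1000000 in
lemma step7c [Fintype F] {p : ℕ} [Fact p.Prime] [CharP F p] {v r : ℕ} (hvr : v * r + 1 = p) (hv : 0 < v)
    (hr : 2 ≤ r) {L N A1 B1 : F[X]} {c0 : F} (hc0 : c0 ≠ 0) (hN0 : N ≠ 0)
    (hL : L = B1 ^ p + X * A1 ^ p) (hco : IsCoprime A1 B1) (hA10 : A1 ≠ 0)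
    (hE : B1 + X ^ p ^ 2 * A1 = C c0 * (L * N ^ r))
    (hdeg : L.natDegree + r * N.natDegree = p ^ 2 + A1.natDegree)
    (hpa : p * A1.natDegree < L.natDegree) (hpb : p * B1.natDegree ≤ L.natDegree)
    (hν : 0 < N.natDegree) : ∃ (u : F) (E : F[X]), N = C u * E ^ v := by
  have hp : p.Prime := Fact.out
  have hpp := hp.pos
  have h2p := hp.two_le
  have hvF : C (v : F) * C (r : F) + 1 = (0 : F[X]) := by
    have : ((v * r + 1 : ℕ) : F) = 0 := by rw [hvr]; simp
    have h3 := congrArg C this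
    simpa using h3
  have hL0 : L ≠ 0 := by rintro rfl; simp at hpa
  have hXp : derivative (X ^ p ^ 2 : F[X]) = 0 := deriv_pow_pp X (by norm_num)
  have hL' : derivative L = A1 ^ p := by
    rw [hL, derivative_add, derivative_mul, deriv_pow_p, deriv_pow_p]; simp
  obtain ⟨r', rfl⟩ : ∃ i, r = i + 1 := ⟨r - 1, by omega⟩
  have hE' : derivative B1 + X ^ p ^ 2 * derivative A1 = C c0 * (A1 ^ p * N ^ (r'+1) + L * (C ((r' + 1 : ℕ) : F) * N ^ r' * derivative N)) := by
    have e := congrArg derivative hE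
    rw [derivative_add, derivative_mul, hXp, derivative_mul, derivative_mul, hL', derivative_C, derivative_pow_succ] at e
    push_cast at e ⊢
    linear_combination e
  set P := C (v : F) * derivative B1 * N + B1 * derivative N with hP
  set Q := C (v : F) * derivative A1 * N + A1 * derivative N with hQ
  have hS : P + X ^ p ^ 2 * Q = C c0 * C (v : F) * A1 ^ p * N ^ (r' + 2) := by
    rw [hP, hQ]
    linear_combination C (v:F) * N * hE' + derivative N * hE + C c0 * L * N ^ (r'+1) * derivative N * hvF
  have hS' : derivative P + X ^ p ^ 2 * derivative Q = C c0 * C (v : F) * A1 ^ p * (C (((r' + 1 : ℕ) : F) + 1) * N ^ (r' + 1) * derivative N) := by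
    have e := congrArg derivative hS
    rw [derivative_add, derivative_mul, hXp, derivative_mul, derivative_mul, derivative_mul, deriv_pow_p, derivative_C, derivative_C, derivative_pow_succ] at e
    push_cast at e ⊢
    linear_combination e
  have hlt : A1.natDegree + B1.natDegree < L.natDegree := by nlinarith
  have hlamnu : B1.natDegree + 2 * N.natDegree < p ^ 2 := by
    have : 2 * N.natDegree ≤ (r'+1) * N.natDegree := Nat.mul_le_mul_right _ hr
    omega
  have hPd : P.natDegree ≤ B1.natDegree + N.natDegree := by
    rw [hP]
    apply (natDegree_add_le _ _).trans
    apply max_le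
    · apply natDegree_mul_le.trans
      have := natDegree_C_mul_le (v:F) (derivative B1)
      have := natDegree_derivative_le B1
      omega
    · apply natDegree_mul_le.trans
      have := natDegree_derivative_le N
      omega
  have hsplit := two_part (f := N * derivative P - C (((r' + 1 : ℕ) : F) + 1) * derivative N * P)
    (h := N * derivative Q - C (((r' + 1 : ℕ) : F) + 1) * derivative N * Q) (Q := p ^ 2) (by
      apply lt_of_le_of_lt (natDegree_sub_le _ _)
      apply max_lt
      · apply lt_of_le_of_lt natDegree_mul_le
        have := natDegree_derivative_le P
        omega
      · apply lt_of_le_of_lt natDegree_mul_le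
        have := natDegree_C_mul_le (((r' + 1 : ℕ) : F) + 1) (derivative N)
        have := natDegree_derivative_le N
        omega) (by
      linear_combination N * hS' - C (((r' + 1 : ℕ) : F) + 1) * derivative N * hS)
  have hQeq := sub_eq_zero.mp hsplit.2
  have hcoAN : IsCoprime A1 N := by
    have h1 : IsCoprime A1 (B1 + A1 * X ^ p ^ 2) := hco.add_mul_left_right _
    rw [mul_comm A1, hE] at h1
    have h2 : N ∣ C c0 * (L * N ^ (r'+1)) := ((dvd_pow_self N (by omega)).mul_left _).mul_left _
    exact h1.of_isCoprime_of_dvd_right h2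
  obtain ⟨u, N1, N2, hu, hN⟩ := glob_mult (p := p) (v := v) N hN0 (by
    intro π E s hπ hNE hd
    refine local_mult hvr (by omega) hπ hNE hd ?_ hQ hQeq
    rintro ⟨hs, hdA⟩
    have hdN : π ∣ N := by rw [hNE]; exact (dvd_pow_self π hs.ne').mul_right _
    exact hπ.not_isUnit (hcoAN.isUnit_of_dvd' hdA hdN))
  have hN10 : N1 ≠ 0 := by
    rintro rfl; rw [zero_pow hv.ne'] at hN; simp at hN; exact hN0 hN
  have hN20 : N2 ≠ 0 := by
    rintro rfl; rw [zero_pow hpp.ne'] at hN; simp at hN; exact hN0 hN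
  have hNd : N.natDegree = v * N1.natDegree + p * N2.natDegree := by
    rw [hN, mul_assoc, natDegree_C_mul hu, natDegree_mul (pow_ne_zero _ hN10) (pow_ne_zero _ hN20), natDegree_pow, natDegree_pow]
  by_cases hν2 : N2.natDegree = 0
  · obtain ⟨y, hy⟩ : ∃ y, N2 = C y := ⟨_, eq_C_of_natDegree_eq_zero hν2⟩
    refine ⟨u * y ^ p, N1, ?_⟩
    rw [hN, hy, C_mul, C_pow]; ring
  obtain ⟨a, ha⟩ : ∃ a, a = A1 * N1 := ⟨_, rfl⟩
  obtain ⟨b, hb⟩ : ∃ b, b = B1 * N1 := ⟨_, rfl⟩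
  have h1 : b + X ^ p ^ 2 * a = C (c0 * u ^ (r'+1)) * ((b ^ p + X * a ^ p) * (N2 ^ (r'+1)) ^ p) := by
    have e1 : N1 * N ^ (r'+1) = C (u ^ (r'+1)) * (N1 ^ p * (N2 ^ (r'+1)) ^ p) := by
      rw [hN, mul_pow, mul_pow, ← hvr, ← pow_mul, pow_succ N1 (v * (r'+1)), C_pow, ← pow_mul N2, ← pow_mul N2]
      rw [show (v * (r'+1) + 1) * (r'+1) = (r'+1) * (v * (r'+1) + 1) by ring]; ring
    rw [hL] at hE
    rw [ha, hb, mul_pow, mul_pow, C_mul]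
    linear_combination N1 * hE + C c0 * (B1 ^ p + X * A1 ^ p) * e1
  set c1 := c0 * u ^ (r'+1) with hc1
  have hc10 : c1 ≠ 0 := mul_ne_zero hc0 (pow_ne_zero _ hu)
  have h2 : derivative b + X ^ p ^ 2 * derivative a = C c1 * (a * N2 ^ (r'+1)) ^ p := by
    have e := congrArg derivative h1
    rw [derivative_add, derivative_mul, hXp, derivative_mul, derivative_mul, derivative_add, derivative_mul,
      deriv_pow_p, deriv_pow_p, deriv_pow_p, derivative_C, derivative_X] at e
    rw [mul_pow]
    linear_combination e
  have h3 : derivative (derivative b) + X ^ p ^ 2 * derivative (derivative a) = 0 := by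
    have e := congrArg derivative h2
    rw [derivative_add, derivative_mul, hXp, derivative_mul, deriv_pow_p, derivative_C] at e
    linear_combination e
  have hbd : b.natDegree ≤ B1.natDegree + N1.natDegree := by rw [hb]; exact natDegree_mul_le
  have had : a.natDegree = A1.natDegree + N1.natDegree := by rw [ha]; exact natDegree_mul hA10 hN10
  have hν1 : N1.natDegree ≤ N.natDegree := by
    rw [hNd]; nlinarith
  obtain ⟨hb2, ha2⟩ := two_part (by
    have := natDegree_derivative_le (derivative b)
    have := natDegree_derivative_le b
    omega) h3
  obtain ⟨α, hα⟩ := exists_pow_of_deriv (p := p) ha2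
  obtain ⟨β, hβ⟩ := exists_pow_of_deriv (p := p) hb2
  obtain ⟨c2, hc2⟩ := exists_root_pp (p := p) c1 1
  rw [pow_one] at hc2
  have hc20 : c2 ≠ 0 := by rintro rfl; rw [zero_pow hpp.ne'] at hc2; exact hc10 hc2.symm
  have h4 : β + X ^ p * α = C c2 * (a * N2 ^ (r'+1)) := by
    apply eq_of_pow_pp (p := p) 1
    have e : β ^ p + X ^ p ^ 2 * α ^ p = (β + X ^ p * α) ^ p := by
      simpa using add_pow_pp (p := p) α β 1 1
    rw [pow_one, ← e, ← hα, ← hβ, mul_pow, ← C_pow, hc2, ← h2]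
  have ha0 : a ≠ 0 := by rw [ha]; exact mul_ne_zero hA10 hN10
  have hrhs : (C c2 * (a * N2 ^ (r'+1))).natDegree = A1.natDegree + N1.natDegree + (r'+1) * N2.natDegree := by
    rw [natDegree_C_mul hc20, natDegree_mul ha0 (pow_ne_zero _ hN20), natDegree_pow, had]
  have hrν : (r'+1) * N.natDegree + N1.natDegree = p * N1.natDegree + (r'+1) * p * N2.natDegree := by
    rw [hNd]
    nth_rewrite 2 [← hvr]; ring
  have hν2' : 0 < N2.natDegree := Nat.pos_of_ne_zero hν2
  have hα0 : α ≠ 0 := by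
    rintro rfl
    rw [mul_zero, add_zero] at h4
    have hβd : β.natDegree = A1.natDegree + N1.natDegree + (r'+1) * N2.natDegree := by rw [h4, hrhs]
    have hb' : (derivative b).natDegree = p * β.natDegree := by rw [hβ, natDegree_pow]
    have hbpos : 0 < (derivative b).natDegree := by
      rw [hb', hβd]; positivity
    have hblt : (derivative b).natDegree < b.natDegree := natDegree_derivative_lt (by
      intro h; have := natDegree_derivative_le b; omega)
    have k1 : p * A1.natDegree + p * N1.natDegree + (r'+1) * p * N2.natDegree < B1.natDegree + N1.natDegree := by
      rw [hb', hβd] at hblt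
      nlinarith
    have k2 : p * A1.natDegree + p ^ 2 + A1.natDegree < B1.natDegree + L.natDegree := by omega
    have hmax : L.natDegree ≤ max (p * B1.natDegree) (1 + p * A1.natDegree) := by
      rw [hL]
      apply (natDegree_add_le _ _).trans
      apply max_le_max
      · rw [natDegree_pow]
      · apply natDegree_mul_le.trans
        rw [natDegree_X, natDegree_pow]
    have hrνpos : 0 < (r'+1) * N.natDegree := by positivity
    rcases le_max_iff.mp hmax with k3 | k3
    · have k4 : L.natDegree = p * B1.natDegree := le_antisymm k3 hpb
      have k5 : A1.natDegree + p ≤ B1.natDegree := by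
        by_contra hcon
        have : B1.natDegree + 1 ≤ A1.natDegree + p := by omega
        nlinarith
      nlinarith
    · have k5 : A1.natDegree + p ^ 2 ≤ B1.natDegree := by omega
      nlinarith
  have hx1 : (p - 1) * (A1.natDegree + N1.natDegree) < (p - 1) * (p - 1) := by
    obtain ⟨p', hp'⟩ : ∃ p', p = p' + 1 := ⟨p - 1, by omega⟩
    rw [hp']; simp only [Nat.add_sub_cancel]
    have k1 : p * A1.natDegree + p * N1.natDegree + (r'+1) * p * N2.natDegree < p ^ 2 + A1.natDegree + N1.natDegree := by omega
    have k2 : 2 * p ≤ (r'+1) * p * N2.natDegree := by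
      calc 2 * p = 2 * p * 1 := by ring
        _ ≤ _ := by gcongr; omega
    rw [hp'] at k1 k2
    nlinarith
  have hx1' : A1.natDegree + N1.natDegree < p - 1 := Nat.lt_of_mul_lt_mul_left hx1
  have hx2 : B1.natDegree + N1.natDegree < p := by
    have k1 : p * B1.natDegree + p * N1.natDegree + (r'+1) * p * N2.natDegree ≤ p ^ 2 + A1.natDegree + N1.natDegree := by omega
    have k2 : 2 * p ≤ (r'+1) * p * N2.natDegree := by
      calc 2 * p = 2 * p * 1 := by ring
        _ ≤ _ := by gcongr; omega
    have k3 : p * (B1.natDegree + N1.natDegree) < p * p := by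
      have : A1.natDegree + N1.natDegree < p := by omega
      nlinarith
    exact Nat.lt_of_mul_lt_mul_left k3
  obtain ⟨x, rfl⟩ : ∃ x, α = C x := ⟨_, eq_C_of_natDegree_eq_zero (by
    have e : (derivative a).natDegree = p * α.natDegree := by rw [hα, natDegree_pow]
    have := natDegree_derivative_le a
    by_contra h
    have : p * 1 ≤ p * α.natDegree := Nat.mul_le_mul_left _ (by omega)
    omega)⟩
  obtain ⟨y, rfl⟩ : ∃ x, β = C x := ⟨_, eq_C_of_natDegree_eq_zero (by
    have e : (derivative b).natDegree = p * β.natDegree := by rw [hβ, natDegree_pow]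
    have := natDegree_derivative_le b
    by_contra h
    have : p * 1 ≤ p * β.natDegree := Nat.mul_le_mul_left _ (by omega)
    omega)⟩
  have hx0 : x ≠ 0 := by rintro rfl; simp at hα0
  obtain ⟨ξ, hξ⟩ := exists_root_pp (p := p) (-(y / x)) 1
  rw [pow_one] at hξ
  have h5 : C x * (X - C ξ) ^ p = C c2 * (a * N2 ^ (r'+1)) := by
    rw [← h4, sub_pow_char, ← C_pow, hξ]
    have : C y = C x * C (y / x) := by rw [← C_mul]; congr 1; field_simp
    rw [this, C_neg]; ring
  obtain ⟨u1, hu1, hN2⟩ := dvd_lin_pow (f := N2) hx0 (m := p) (ξ := ξ) (by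
    rw [h5]; exact ((dvd_pow_self N2 (by omega)).mul_left _).mul_left _)
  obtain ⟨u2, hu2, hae⟩ := dvd_lin_pow (f := a) hx0 (m := p) (ξ := ξ) (by
    rw [h5]; exact (dvd_mul_right _ _).mul_left _)
  have hda : derivative a = C (x ^ p) := by rw [hα, C_pow]
  have hda0 : derivative a ≠ 0 := by rw [hda]; exact C_ne_zero.mpr (pow_ne_zero _ hx0)
  have ha1 : a.natDegree = 1 := by
    have hpos : a.natDegree ≠ 0 := by
      intro h; apply hda0; rw [eq_C_of_natDegree_eq_zero h]; simp
    obtain ⟨i, hi⟩ := Nat.exists_eq_succ_of_ne_zero hpos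
    rw [hi] at hae
    have e : derivative a = C (u2 * ((i : F) + 1)) * (X - C ξ) ^ i := by
      rw [hae, derivative_mul, derivative_pow_succ]; simp; ring
    have hne : u2 * ((i : F) + 1) ≠ 0 := by
      intro h; rw [h] at e; simp at e; exact hda0 e
    have e2 := congrArg natDegree e
    rw [hda, natDegree_C, natDegree_C_mul hne, natDegree_pow, natDegree_X_sub_C] at e2
    omega
  have hνv : N2.natDegree = v := by
    have e := congrArg natDegree h5
    rw [hrhs, ← had, ha1, natDegree_C_mul hx0, natDegree_pow, natDegree_X_sub_C, mul_one] at e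
    have : (r'+1) * N2.natDegree = (r'+1) * v := by nth_rewrite 2 [mul_comm]; omega
    exact Nat.eq_of_mul_eq_mul_left (by omega) this
  refine ⟨u * u1 ^ p, N1 * (X - C ξ) ^ p, ?_⟩
  rw [hN, hN2, hνv, mul_pow, mul_pow, C_mul, C_pow]
  ring

end MV

namespace MV
variable {F : Type*} [Field F]

set_option maxHeartbeats 800000 in
lemma step7 [Fintype F] {p : ℕ} [Fact p.Prime] [CharP F p] {n K v r : ℕ} (hq : Fintype.card F = p ^ n)
    {L g N Ak Bk : F[X]} {a0 c : F} (ha0 : a0 ≠ 0) (hc : c ≠ 0) (hN0 : N ≠ 0) (hLm : L.Monic)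
    (hA : derivative L = Ak ^ p ^ K) (hB : L - X * derivative L = Bk ^ p ^ K)
    (hA0 : derivative L ≠ 0) (hco : IsCoprime (derivative L) (L - X * derivative L))
    (hC : C a0 * (L - X * derivative L + X ^ p ^ n * derivative L) = -L * g ^ r * ((1 : F[X]).comp g) ^ p ^ K)
    (hg : g = C c * (L ^ v * N ^ p ^ K)) (hvr : v * r + 1 = p ^ K) (hv : 0 < v) (hr : 2 ≤ r)
    (hKn : K ≤ n) (hKd : K ∣ n) (hn : 0 < n) (hbig : p ^ n < (p * (r + 1)) ^ 2)
    (hdeg : p ^ K * L.natDegree + r * p ^ K * N.natDegree = p ^ n + (derivative L).natDegree)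
    (hν : 0 < N.natDegree) : ∃ (u : F) (E : F[X]), g = C u * E ^ v := by
  have hp : p.Prime := Fact.out
  have h2p := hp.two_le
  obtain ⟨n', rfl⟩ : ∃ n', n = n' + K := ⟨n - K, by omega⟩
  obtain ⟨c0, hc0, hE⟩ := root_eq (n' := n') (κ := K) (κ' := 0) (v := v) (ρ := r) (V1 := 1) (N := N) ha0 hc hA hB hC
    (by rw [hg, zero_add]) hvr
  rw [one_comp, mul_one, pow_zero, one_mul] at hE
  have hMpos : 0 < p ^ K := by positivity
  have hM3 : 3 ≤ p ^ K := by rw [← hvr]; nlinarith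
  have hrM : r + 1 ≤ p ^ K := by rw [← hvr]; nlinarith
  have hAd : (derivative L).natDegree = p ^ K * Ak.natDegree := by rw [hA, natDegree_pow]
  have hd2 : L.natDegree + r * N.natDegree = p ^ n' + Ak.natDegree := by
    apply Nat.eq_of_mul_eq_mul_left hMpos
    rw [hAd, pow_add] at hdeg
    linarith
  have hLnd : L.natDegree ≠ 0 := by
    intro h; apply hA0; rw [eq_C_of_natDegree_eq_zero h]; simp
  have hMa : p ^ K * Ak.natDegree < L.natDegree := by
    rw [← hAd]; exact natDegree_derivative_lt hLnd
  have hMb : p ^ K * Bk.natDegree ≤ L.natDegree := by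
    rw [← natDegree_pow, ← hB]
    apply (natDegree_sub_le _ _).trans
    apply max_le le_rfl
    apply natDegree_mul_le.trans
    have := natDegree_derivative_lt hLnd
    rw [natDegree_X]; omega
  have hrν : 2 ≤ r * N.natDegree := by nlinarith
  have hsmall : n' + K < 2 + 2 * K := by
    have h1 : (p * (r+1)) ^ 2 ≤ p ^ (2 + 2 * K) := by
      rw [mul_pow, pow_add, pow_mul' p 2 K]
      gcongr
    exact (Nat.pow_lt_pow_iff_right hp.one_lt).mp (hbig.trans_le h1)
  obtain ⟨s, hs⟩ := hKd
  have hK0 : 0 < K := by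
    rcases Nat.eq_zero_or_pos K with h | h
    · subst h; simp at hM3
    · exact h
  have hs1 : 1 ≤ s := by
    rcases Nat.eq_zero_or_pos s with h | h
    · subst h; omega
    · exact h
  rcases (show s = 1 ∨ s = 2 ∨ 3 ≤ s by omega) with rfl | rfl | hs3
  · exfalso
    have : n' = 0 := by omega
    subst this
    rw [pow_zero] at hd2
    nlinarith
  · have : n' = K := by omega
    subst this
    have ha' : Ak.natDegree = 0 := by
      by_contra h
      have : 1 ≤ Ak.natDegree := by omega
      nlinarith
    have hlM : L.natDegree < p ^ n' := by omega
    have hb' : Bk.natDegree = 0 := by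
      by_contra h
      have : p ^ n' * 1 ≤ p ^ n' * Bk.natDegree := Nat.mul_le_mul_left _ (by omega)
      omega
    have hl1 : L.natDegree = 1 := by
      apply le_antisymm _ (by omega)
      have e : L = Bk ^ p ^ n' + X * Ak ^ p ^ n' := by rw [← hA, ← hB]; ring
      rw [e]
      apply (natDegree_add_le _ _).trans
      apply max_le
      · rw [natDegree_pow, hb']; simp
      · apply natDegree_mul_le.trans
        rw [natDegree_pow, ha', natDegree_X]; simp
    have hνv : N.natDegree = v := by
      have : r * N.natDegree = r * v := by rw [mul_comm r v]; omega
      exact Nat.eq_of_mul_eq_mul_left (by omega) this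
    obtain ⟨β, hL⟩ : ∃ β, L = X + C β := ⟨_, hLm.eq_X_add_C hl1⟩
    have hL' : derivative L = 1 := by rw [hL]; simp
    have hβ : β ^ p ^ (n' + n') = β := by rw [← hq]; exact FiniteField.pow_card β
    have hkey : C a0 * (X - C (-β)) ^ p ^ (n' + n') = -L * g ^ r := by
      rw [C_neg, sub_neg_eq_add, add_pow_char_pow, ← C_pow, hβ]
      rw [hL', one_comp, one_pow, mul_one, mul_one, mul_one] at hC
      rw [← hC, hL, add_sub_cancel_left, add_comm]
    obtain ⟨u, hu, hgu⟩ := dvd_lin_pow (f := g) (m := p ^ (n' + n')) (ξ := -β) ha0 (by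
      rw [hkey]; exact (dvd_pow_self g (by omega)).mul_left _)
    have hgd : g.natDegree = (1 + p ^ n') * v := by
      rw [hg, natDegree_C_mul hc, natDegree_mul (pow_ne_zero _ hLm.ne_zero) (pow_ne_zero _ hN0), natDegree_pow,
        natDegree_pow, hl1, hνv]; ring
    refine ⟨u, (X - C (-β)) ^ (1 + p ^ n'), ?_⟩
    rw [← pow_mul, ← hgd]; exact hgu
  · have hK1 : K = 1 := by nlinarith
    subst hK1
    have hn2 : n' = 2 := by omega
    subst hn2
    rw [pow_one] at *
    have hcoAB : IsCoprime Ak Bk := by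
      rw [hB, hA] at hco
      exact (IsCoprime.pow_iff hp.pos hp.pos).mp hco
    have hA10 : Ak ≠ 0 := by
      rintro rfl; rw [zero_pow hp.ne_zero] at hA; exact hA0 hA
    obtain ⟨u, E, hNE⟩ := step7c hvr hv hr hc0 hN0 (L := L) (by rw [← hB, ← hA]; ring) hcoAB hA10 hE hd2 hMa hMb hν
    refine ⟨c * u ^ p, L * E ^ p, ?_⟩
    rw [hg, hNE, mul_pow, mul_pow, C_mul, C_pow]; ring

/-- the core: every `g` is a constant times a `v`-th power. -/
lemma core [Fintype F] {p : ℕ} [Fact p.Prime] [CharP F p] {n K κ v r ρ : ℕ} (hn : 0 < n) (hq : Fintype.card F = p ^ n)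
    (hv : 0 < v) (hr : 2 ≤ r) (hvr : v * r + 1 = p ^ K) (hKn : K ≤ n) {W V1 : F[X]} (hWm : W.Monic)
    (hWd : W.natDegree = r) {a0 b0 : F} (ha0 : a0 ≠ 0) (hb0 : b0 ≠ 0)
    (hW1 : C (v : F) * X * derivative W + W = C a0) (hW2 : W = C a0 + X ^ ρ * V1 ^ p ^ κ)
    (hρ : 0 < ρ) (hvρ : v * ρ + 1 = p ^ κ) (hV : C (v : F) * X * derivative V1 + V1 = C b0)
    (hbig : p ^ n < (p * (r + 1)) ^ 2)
    (hcase : (ρ < r ∧ κ < K ∧ r = ρ + p ^ κ * V1.natDegree) ∨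
      (V1 = 1 ∧ ρ = r ∧ κ = K ∧ K ∣ n ∧ ∀ j, 0 < j → r ∣ p ^ j - 1 → K ≤ j))
    {g : F[X]} (hg : 0 < g.natDegree) (hd : r * g.natDegree < p ^ n)
    (hz : ∀ a, g.eval a * W.eval (g.eval a) = 0) : ∃ (u : F) (E : F[X]), g = C u * E ^ v := by
  have hp : p.Prime := Fact.out
  have hK0 : K ≠ 0 := by
    rintro rfl; rw [pow_zero] at hvr; nlinarith
  have hvF : (v : F) ≠ 0 := by
    intro h
    have : ((v * r + 1 : ℕ) : F) = 0 := by rw [hvr]; simp [hK0]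
    push_cast at this; rw [h] at this; simp at this
  have hV0 : V1.eval 0 ≠ 0 := by
    have := congrArg (eval 0) hV
    simp at this; rw [this]; exact hb0
  have hρr : ρ ≤ r := by rcases hcase with h | h <;> omega
  have hκn : κ ≤ n := by rcases hcase with h | h <;> omega
  obtain ⟨L, D, α, μ, hLm, hLD, hWL, hL2, hLg, hLpos, hLα, hμ, hμ'⟩ := step2 hn hq hr hvF hWd ha0 hW1 hg hd hz
  have hC := step3 hLD hWL hW2
  obtain ⟨hco, hLv, Ak, Bk, hA, hB⟩ := step4 (v := v) (r := r) (κ := κ) hn ha0 hLD hL2 hg hLg hLpos hLα hμ hμ' hd hV0 hρ hρr hvρ hv hκn hC (by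
    rcases hcase with h | ⟨h1, h2, h3, h4, h5⟩
    · exact Or.inl ⟨h.1, h.2.2⟩
    · right; subst h2; subst h3; exact h5)
  obtain ⟨N, P, c, c', hc, hc', hN0, hgN, hA0, hP⟩ := step5 ha0 hr hLm hLD hWL hW2 hρ hWm hWd hvr hv hKn hg hLpos hd hLv
  have hq1 : 1 < p ^ n := Nat.one_lt_pow hn.ne' hp.one_lt
  have hdeg := deg_eq hq1 ha0 hc hN0 hLm hA0 hLD hWL hWd hvr hgN
  rcases Nat.eq_zero_or_pos N.natDegree with hν | hν
  · rw [eq_C_of_natDegree_eq_zero hν] at hgN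
    refine ⟨c * N.coeff 0 ^ p ^ K, L, ?_⟩
    rw [hgN, C_mul, C_pow]; ring
  rcases hcase with ⟨h1, h2, h3⟩ | ⟨rfl, rfl, rfl, h4, h5⟩
  · exact (step6 ha0 hc hc' hN0 hA hB hA0 hLm.ne_zero hC hgN hvρ hv hρ hP h2 hKn hvr hbig hV hb0 hdeg hν).elim
  · exact step7 hq ha0 hc hN0 hLm hA hB hA0 hco hC hgN hvr hv hr hKn h4 hn hbig hdeg hν

end MV

namespace MV
variable {F : Type*} [Field F]

lemma card_le_deg_mul [Fintype F] [DecidableEq F] (f : F[X]) (hf : 0 < f.natDegree) :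
    Fintype.card F ≤ f.natDegree * (valueSet f).card := by
  unfold valueSet
  apply Finset.card_le_mul_card_image
  intro b _
  have hne : f - C b ≠ 0 := by
    intro h
    have : f = C b := sub_eq_zero.mp h
    rw [this] at hf; simp at hf
  have h1 : (Finset.univ.filter fun a => f.eval a = b) ⊆ (f - C b).roots.toFinset := by
    intro a ha
    simp at ha
    rw [Multiset.mem_toFinset, mem_roots hne]
    simp [IsRoot, ha]
  refine (Finset.card_le_card h1).trans ((Multiset.toFinset_card_le _).trans ((card_roots' _).trans ?_))
  rw [natDegree_sub_C]

lemma wrap [Fintype F] [DecidableEq F] {v r : ℕ} (hv : 0 < v) (hr : 1 ≤ r) (U : Finset F)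
    (hU : U.card = v * r + 1) (hS : (U.image (fun u => u ^ v)).card = r + 1)
    (hζ : ∀ ζ : F, ζ ^ v = 1 → ∀ u ∈ U, ζ * u ∈ U) (h0 : (0 : F) ∈ U)
    (hcore : ∀ g ∈ MVSPset (U.image (fun u => u ^ v)), ∃ (c : F) (f : F[X]), g = C c * f ^ v) :
    MVSPset (U.image (fun u => u ^ v)) = {g | ∃ f ∈ MVSPset U, g = f ^ v} := by
  ext g
  constructor
  · intro hg
    obtain ⟨c, f, hgf⟩ := hcore g hg
    obtain ⟨⟨hgd, hgc⟩, hgS⟩ := hg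
    rw [hgS, hS] at hgc
    have hc : c ≠ 0 := by rintro rfl; rw [hgf] at hgd; simp at hgd
    have hgn : g.natDegree = v * f.natDegree := by rw [hgf, natDegree_C_mul hc, natDegree_pow]
    obtain ⟨s, hsS, hs0⟩ : ∃ s ∈ U.image (fun u => u ^ v), s ≠ 0 := by
      apply Finset.exists_mem_ne (by omega)
    obtain ⟨u, hu, hus⟩ := Finset.mem_image.mp hsS
    rw [← hgS] at hsS
    obtain ⟨x0, -, hx0⟩ := Finset.mem_image.mp hsS
    have hcf : c * f.eval x0 ^ v = s := by rw [← hx0, hgf]; simp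
    have hfx : f.eval x0 ≠ 0 := by
      intro h; rw [h, zero_pow hv.ne', mul_zero] at hcf; exact hs0 hcf.symm
    have hc2 : c = (u / f.eval x0) ^ v := by
      rw [div_pow, hus, ← hcf]; field_simp
    have hd0 : u / f.eval x0 ≠ 0 := by
      intro h; rw [h, zero_pow hv.ne'] at hc2; exact hc hc2
    have hgf1 : g = (C (u / f.eval x0) * f) ^ v := by rw [mul_pow, ← C_pow, ← hc2, hgf]
    have hfn : (C (u / f.eval x0) * f).natDegree = f.natDegree := natDegree_C_mul hd0
    generalize C (u / f.eval x0) * f = f1 at hgf1 hfn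
    rw [← hfn] at hgn
    have hDpos : 0 < f1.natDegree := by
      apply Nat.pos_of_ne_zero; intro h; rw [h] at hgn; omega
    have hsub : valueSet f1 ⊆ U := by
      intro y hy
      obtain ⟨a, -, ha⟩ := Finset.mem_image.mp hy
      have hyS : y ^ v ∈ U.image (fun u => u ^ v) := by
        rw [← hgS]; apply Finset.mem_image.mpr
        exact ⟨a, Finset.mem_univ _, by rw [hgf1, eval_pow, ha]⟩
      obtain ⟨w, hw, hwy⟩ := Finset.mem_image.mp hyS
      by_cases hw0 : w = 0
      · rw [hw0, zero_pow hv.ne'] at hwy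
        rw [pow_eq_zero_iff hv.ne' |>.mp hwy.symm]; exact h0
      · have := hζ (y / w) (by rw [div_pow, hwy, div_self]; rw [← hwy]; exact pow_ne_zero _ hw0) w hw
        rwa [div_mul_cancel₀ _ hw0] at this
    have k1 := card_le_deg_mul f1 hDpos
    have hq := Fintype.card_pos (α := F)
    have k2 : (Fintype.card F - 1) / f1.natDegree + 1 ≤ (valueSet f1).card := by
      apply (Nat.div_lt_iff_lt_mul hDpos).mpr
      rw [mul_comm]; omega
    have k3 := Finset.card_le_card hsub
    have k4 : v * r ≤ (Fintype.card F - 1) / f1.natDegree := by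
      have : (Fintype.card F - 1) / g.natDegree = r := by omega
      rw [hgn, mul_comm v, ← Nat.div_div_eq_div_mul] at this
      rw [← this]; exact Nat.mul_div_le _ _
    refine ⟨f1, ⟨⟨hDpos, by omega⟩, ?_⟩, hgf1⟩
    exact Finset.eq_of_subset_of_card_le hsub (by omega)
  · rintro ⟨f, ⟨⟨hfd, hfc⟩, hfU⟩, rfl⟩
    have hval : valueSet (f ^ v) = U.image (fun u => u ^ v) := by
      rw [← hfU]; unfold valueSet; rw [Finset.image_image]
      congr 1; ext a; simp
    refine ⟨⟨?_, ?_⟩, hval⟩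
    · rw [natDegree_pow]; positivity
    · rw [hval, hS, natDegree_pow, mul_comm v, ← Nat.div_div_eq_div_mul]
      rw [hfU, hU] at hfc
      have : (Fintype.card F - 1) / f.natDegree = v * r := by omega
      rw [this, Nat.mul_div_cancel_left _ hv]

/-- degree bound for members of `MVSPset S`. -/
lemma deg_bound [Fintype F] [DecidableEq F] {S : Finset F} {r : ℕ} (hS : S.card = r + 1) {g : F[X]} (hg : g ∈ MVSPset S) :
    0 < g.natDegree ∧ r * g.natDegree < Fintype.card F ∧ ∀ a, g.eval a ∈ S := by
  obtain ⟨⟨hgd, hgc⟩, hgS⟩ := hg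
  rw [hgS, hS] at hgc
  refine ⟨hgd, ?_, ?_⟩
  · have : (Fintype.card F - 1) / g.natDegree = r := by omega
    have h2 := Nat.div_mul_le_self (Fintype.card F - 1) g.natDegree
    have hq := Fintype.card_pos (α := F)
    rw [this] at h2; omega
  · intro a; rw [← hgS]; exact Finset.mem_image.mpr ⟨a, Finset.mem_univ _, rfl⟩

/-- cardinality of the image under `v`-th power, lower bound. -/
lemma card_image_pow [DecidableEq F] {v r : ℕ} (hv : 0 < v) (U : Finset F)
    (hU : U.card = v * r + 1) (h0 : (0 : F) ∈ U) : r + 1 ≤ (U.image (fun u => u ^ v)).card := by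
  have h1 : ((U.erase 0).card) ≤ v * ((U.erase 0).image (fun u => u ^ v)).card := by
    apply Finset.card_le_mul_card_image
    intro b _
    have hne : (X ^ v - C b : F[X]) ≠ 0 := X_pow_sub_C_ne_zero hv b
    have h1 : ((U.erase 0).filter fun a => a ^ v = b) ⊆ (X ^ v - C b : F[X]).roots.toFinset := by
      intro a ha
      rw [Finset.mem_filter] at ha
      rw [Multiset.mem_toFinset, mem_roots hne]
      simp [IsRoot, ha.2]
    refine (Finset.card_le_card h1).trans ((Multiset.toFinset_card_le _).trans ((card_roots' _).trans ?_))
    rw [natDegree_X_pow_sub_C]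
  rw [Finset.card_erase_of_mem h0, hU, Nat.add_sub_cancel] at h1
  have h2 : r ≤ ((U.erase 0).image (fun u => u ^ v)).card := Nat.le_of_mul_le_mul_left h1 hv
  have h3 : ((U.erase 0).image (fun u => u ^ v)) ⊆ (U.image (fun u => u ^ v)).erase 0 := by
    intro s hs
    obtain ⟨u, hu, hus⟩ := Finset.mem_image.mp hs
    rw [Finset.mem_erase] at hu
    refine Finset.mem_erase.mpr ⟨?_, Finset.mem_image.mpr ⟨u, hu.2, hus⟩⟩
    rw [← hus]; exact pow_ne_zero _ hu.1
  have h4 : (0:F) ∈ U.image (fun u => u ^ v) := Finset.mem_image.mpr ⟨0, h0, zero_pow hv.ne'⟩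
  have h5 := Finset.card_le_card h3
  rw [Finset.card_erase_of_mem h4] at h5
  have : 0 < (U.image (fun u => u ^ v)).card := Finset.card_pos.mpr ⟨_, h4⟩
  omega

end MV

namespace MV
variable {F : Type*} [Field F]

lemma card_filter_pow_le [Fintype F] [DecidableEq F] {d : ℕ} (hd : 0 < d) :
    (Finset.univ.filter (fun s : F => s ^ (d + 1) = s)).card ≤ d + 1 := by
  have hnd := FiniteField.X_pow_card_sub_X_natDegree_eq F (show 1 < d + 1 by omega)
  have hne : (X ^ (d + 1) - X : F[X]) ≠ 0 := FiniteField.X_pow_card_sub_X_ne_zero F (by omega)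
  have h1 : (Finset.univ.filter (fun s : F => s ^ (d + 1) = s)) ⊆ (X ^ (d + 1) - X : F[X]).roots.toFinset := by
    intro a ha
    rw [Finset.mem_filter] at ha
    rw [Multiset.mem_toFinset, mem_roots hne]
    simp [IsRoot, ha.2]
  refine (Finset.card_le_card h1).trans ((Multiset.toFinset_card_le _).trans ((card_roots' _).trans ?_))
  rw [hnd]

lemma pow_succ_eq_iff {d : ℕ} (x : F) : x ^ (d + 1) = x ↔ x = 0 ∨ x ^ d = 1 := by
  rw [pow_succ]
  constructor
  · intro h
    by_cases hx : x = 0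
    · exact Or.inl hx
    · right; exact mul_right_cancel₀ hx (by rw [h, one_mul])
  · rintro (h | h)
    · simp [h]
    · rw [h, one_mul]

/-- image of `{c : c^(v r + 1) = c}` under `v`-th power. -/
lemma image_filter [Fintype F] [DecidableEq F] {v r : ℕ} (hv : 0 < v) (hr : 0 < r) (U : Finset F)
    (hU : U.card = v * r + 1) (h0 : (0 : F) ∈ U) (hs : ∀ u ∈ U, u ^ (v * r + 1) = u) :
    U.image (fun u => u ^ v) = Finset.univ.filter (fun s : F => s ^ (r + 1) = s) ∧
    (U.image (fun u => u ^ v)).card = r + 1 := by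
  have h1 := card_image_pow hv U hU h0
  have h2 := card_filter_pow_le (F := F) hr
  have h3 : U.image (fun u => u ^ v) ⊆ Finset.univ.filter (fun s : F => s ^ (r + 1) = s) := by
    intro s hsS
    obtain ⟨u, hu, hus⟩ := Finset.mem_image.mp hsS
    rw [Finset.mem_filter]
    refine ⟨Finset.mem_univ _, ?_⟩
    rw [pow_succ_eq_iff, ← hus]
    rcases (pow_succ_eq_iff u).mp (hs u hu) with h | h
    · left; rw [h]; exact zero_pow hv.ne'
    · right; rw [← pow_mul]; exact h
  exact ⟨Finset.eq_of_subset_of_card_le h3 (by omega), le_antisymm ((Finset.card_le_card h3).trans h2) h1⟩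

lemma card_filter_pow [Fintype F] [DecidableEq F] {d : ℕ} (hd : 0 < d) (hdq : d ∣ Fintype.card F - 1) :
    (Finset.univ.filter (fun s : F => s ^ (d + 1) = s)).card = d + 1 := by
  obtain ⟨w, hw⟩ := hdq
  have hq := Fintype.one_lt_card (α := F)
  have hw0 : 0 < w := by
    apply Nat.pos_of_ne_zero; rintro rfl; rw [mul_zero] at hw; omega
  have hc : Fintype.card F = w * d + 1 := by rw [mul_comm]; omega
  have := image_filter (F := F) hw0 hd Finset.univ (by rw [Finset.card_univ, hc]) (Finset.mem_univ _)
    (fun u _ => by rw [← hc]; exact FiniteField.pow_card u)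
  rw [← this.1]; exact this.2

lemma part2 [Fintype F] [DecidableEq F] {p : ℕ} [Fact p.Prime] [CharP F p] {n K v : ℕ} (hn : 0 < n)
    (hq : Fintype.card F = p ^ n) (hv : 0 < v) (hvd : v ∣ p ^ K - 1)
    (U : Finset F) (hUcard : U.card = p ^ K)
    (hUv : 2 < (U.image (fun u => u ^ v)).card)
    (hbig : p ^ n < (p * (U.image (fun u => u ^ v)).card) ^ 2)
    (hU : U = Finset.univ.filter (fun c : F => c ^ p ^ K = c))
    (e t : ℕ) (he : 0 < e) (hse : ∀ s ∈ U.image (fun u => u ^ v), s ^ p ^ e = s)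
    (hmin : ∀ e', 0 < e' → (∀ s ∈ U.image (fun u => u ^ v), s ^ p ^ e' = s) → e ≤ e')
    (ht : t * (p ^ K - 1) = v * (p ^ e - 1)) :
    MVSPset (U.image (fun u => u ^ v)) =
          {g | ∃ f ∈ MVSPset (Finset.univ.filter (fun c : F => c ^ p ^ e = c)), g = f ^ t} := by
  have hp : p.Prime := Fact.out
  have hMpos : 0 < p ^ K := pow_pos hp.pos _
  have hepos : 1 < p ^ e := Nat.one_lt_pow he.ne' hp.one_lt
  obtain ⟨r, hr⟩ := hvd
  have hM : p ^ K = v * r + 1 := by omega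
  have hM2 : 2 < p ^ K := by rw [← hUcard]; exact hUv.trans_le Finset.card_image_le
  have hr0 : 0 < r := by
    apply Nat.pos_of_ne_zero; rintro rfl; rw [mul_zero] at hr; omega
  have h0U : (0:F) ∈ U := by
    rw [hU, Finset.mem_filter]; exact ⟨Finset.mem_univ _, zero_pow hMpos.ne'⟩
  obtain ⟨hSf, hSc⟩ := image_filter hv hr0 U (by rw [hUcard, hM]) h0U (fun u hu => by
    rw [hU, Finset.mem_filter] at hu; rw [← hM]; exact hu.2)
  have hr2 : 2 ≤ r := by omega
  have htr : t * r = p ^ e - 1 := by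
    apply Nat.eq_of_mul_eq_mul_left hv
    rw [← ht, hr]; ring
  have htr1 : t * r + 1 = p ^ e := by omega
  have ht0 : 0 < t := by
    apply Nat.pos_of_ne_zero; rintro rfl; rw [zero_mul] at htr; omega
  have hmin' : ∀ j, 0 < j → r ∣ p ^ j - 1 → e ≤ j := by
    rintro j hj ⟨w, hw⟩
    have hjpos : 1 < p ^ j := Nat.one_lt_pow hj.ne' hp.one_lt
    apply hmin j hj
    intro s hs
    rw [hSf, Finset.mem_filter] at hs
    rw [show p ^ j = (p ^ j - 1) + 1 by omega, pow_succ_eq_iff]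
    rcases (pow_succ_eq_iff s).mp hs.2 with h | h
    · exact Or.inl h
    · right; rw [hw, pow_mul, h, one_pow]
  have hen : e ∣ n := by
    have h1 : e ≤ Nat.gcd e n := by
      apply hmin _ (Nat.gcd_pos_of_pos_left _ he)
      intro s hs
      have k1 : Function.IsPeriodicPt (frobenius F p) e s := by
        rw [Function.IsPeriodicPt, Function.IsFixedPt, iterate_frobenius]; exact hse s hs
      have k2 : Function.IsPeriodicPt (frobenius F p) n s := by
        rw [Function.IsPeriodicPt, Function.IsFixedPt, iterate_frobenius, ← hq]; exact FiniteField.pow_card s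
      have := k1.gcd k2
      rwa [Function.IsPeriodicPt, Function.IsFixedPt, iterate_frobenius] at this
    have h2 : Nat.gcd e n = e := le_antisymm (Nat.gcd_le_left _ he) h1
    rw [← h2]; exact Nat.gcd_dvd_right _ _
  have hdq : p ^ e - 1 ∣ Fintype.card F - 1 := by
    rw [hq]; exact Nat.pow_sub_one_dvd_pow_sub_one p hen
  have hU'c := card_filter_pow (F := F) (d := p ^ e - 1) (by omega) hdq
  rw [show p ^ e - 1 + 1 = p ^ e by omega] at hU'c
  obtain ⟨U', hU'⟩ : ∃ U', U' = Finset.univ.filter (fun c : F => c ^ p ^ e = c) := ⟨_, rfl⟩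
  rw [← hU'] at hU'c ⊢
  have hmem : ∀ x, x ∈ U' ↔ x ^ p ^ e = x := by intro x; rw [hU', Finset.mem_filter]; simp
  have h0U' : (0:F) ∈ U' := by rw [hmem]; exact zero_pow (by omega)
  obtain ⟨hSf', hSc'⟩ := image_filter ht0 hr0 U' (by rw [hU'c, htr1]) h0U' (fun u hu => by
    rw [htr1]; exact (hmem u).mp hu)
  have hSS : U.image (fun u => u ^ v) = U'.image (fun u => u ^ t) := by rw [hSf, hSf']
  rw [hSc] at hbig
  rw [hSS]
  refine wrap ht0 (by omega) U' (by rw [hU'c, htr1]) hSc' ?_ h0U' ?_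
  · intro ζ hζ u hu
    rw [hmem] at hu ⊢
    rw [mul_pow, hu, ← htr1, pow_succ, pow_mul, hζ, one_pow, one_mul]
  · intro g hg
    obtain ⟨hg1, hg2, hg3⟩ := deg_bound hSc' hg
    have hne : (-1 : F) ≠ 0 := neg_ne_zero.mpr one_ne_zero
    refine core (p := p) (K := e) (κ := e) (W := X ^ r + C (-1)) (V1 := 1) (a0 := -1) (b0 := 1) hn hq ht0 hr2 htr1
      (Nat.le_of_dvd hn hen) (monic_X_pow_add_C _ (by omega)) (natDegree_X_pow_add_C) hne one_ne_zero ?_ ?_ hr0 htr1 ?_ hbig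
      (Or.inr ⟨rfl, rfl, rfl, hen, hmin'⟩) hg1 (by rw [← hq]; exact hg2) ?_
    · have hz : ((t * r + 1 : ℕ) : F) = 0 := by rw [htr1]; simp [he.ne']
      have hz2 := congrArg C hz
      push_cast at hz2
      simp only [C_add, C_mul, C_1, C_0] at hz2
      obtain ⟨r', rfl⟩ : ∃ r', r = r' + 1 := ⟨r - 1, by omega⟩
      rw [derivative_add, derivative_X_pow_succ, derivative_C]
      push_cast at hz2 ⊢
      simp only [C_add, C_1, C_neg] at hz2 ⊢
      linear_combination X ^ (r'+1) * hz2
    · rw [one_pow, mul_one, add_comm]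
    · simp
    · intro a
      have := hg3 a
      rw [hSf', Finset.mem_filter] at this
      have h := this.2
      rw [pow_succ] at h
      simp only [eval_add, eval_pow, eval_X, eval_C]
      linear_combination h

end MV

namespace MV
variable {F : Type*} [Field F]

lemma coeff_pow_pp {p : ℕ} [Fact p.Prime] [CharP F p] (h : F[X]) (j i : ℕ) :
    (h ^ p ^ j).coeff i = if p ^ j ∣ i then h.coeff (i / p ^ j) ^ p ^ j else 0 := by
  have hp : p.Prime := Fact.out
  rw [← map_iterateFrobenius_expand p h j, coeff_map, coeff_expand (pow_pos hp.pos _)]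
  split_ifs
  · rw [iterateFrobenius_def]
  · simp

lemma lin [Fintype F] {p : ℕ} [Fact p.Prime] [CharP F p] (d : ℕ) : ∀ f : F[X], f.natDegree ≤ d →
    f.natDegree ≤ Fintype.card F → (∀ y : F, f.comp (X + C y) = f + C (f.eval y)) →
    ∀ i, f.coeff i ≠ 0 → ∃ j, i = p ^ j := by
  have hp : p.Prime := Fact.out
  induction d using Nat.strong_induction_on with
  | _ d ih =>
  intro f hfd hfq hf i hi
  have hf0 : f.coeff 0 = 0 := by
    have := congrArg (eval 0) (hf 0)
    simp [← coeff_zero_eq_eval_zero] at this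
    exact this
  rcases Nat.eq_zero_or_pos f.natDegree with hd0 | hdpos
  · exfalso
    rw [eq_C_of_natDegree_eq_zero hd0, hf0] at hi
    simp at hi
  have hder : ∀ y, (derivative f).eval y = (derivative f).eval 0 := by
    intro y
    have := congrArg (fun g => (derivative g).eval 0) (hf y)
    simp [derivative_comp] at this
    exact this
  have hdc : derivative f = C ((derivative f).eval 0) := by
    apply eq_of_degree_sub_lt_of_eval_finset_eq Finset.univ
    · apply lt_of_le_of_lt degree_le_natDegree
      rw [natDegree_sub_C, Finset.card_univ]
      have := natDegree_derivative_lt hdpos.ne'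
      exact_mod_cast this.trans_le hfq
    · intro x _; rw [eval_C]; exact hder x
  generalize (derivative f).eval 0 = c at hdc
  obtain ⟨h1, hh1⟩ := exists_pow_of_deriv (p := p) (f := f - C c * X) (by
    rw [derivative_sub, hdc]; simp)
  have hfe : f = C c * X + h1 ^ p := by rw [← hh1]; ring
  have hh1a : ∀ y : F, h1.comp (X + C y) = h1 + C (h1.eval y) := by
    intro y
    apply eq_of_pow_pp (p := p) 1
    rw [pow_one, add_pow_char, ← pow_comp, ← hh1, ← C_pow, ← eval_pow, ← hh1, sub_comp, hf y]
    simp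
    ring
  have hdeg : p * h1.natDegree ≤ f.natDegree := by
    rw [← natDegree_pow, ← hh1]
    apply (natDegree_sub_le _ _).trans
    apply max_le le_rfl
    exact (natDegree_C_mul_le c X).trans (by rw [natDegree_X]; exact hdpos)
  have h2 := hp.two_le
  have hlt : h1.natDegree < f.natDegree := by nlinarith
  have key := ih h1.natDegree (by omega) h1 le_rfl (by omega) hh1a
  by_cases hi1 : i = 1
  · exact ⟨0, by rw [hi1, pow_zero]⟩
  rw [hfe, coeff_add, coeff_C_mul, coeff_X_of_ne_one hi1, mul_zero, zero_add] at hi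
  have e := coeff_pow_pp (p := p) h1 1 i
  rw [pow_one] at e
  rw [e] at hi
  split_ifs at hi with hd
  · obtain ⟨j, hj⟩ := key (i / p) (by intro h; rw [h, zero_pow hp.ne_zero] at hi; exact hi rfl)
    exact ⟨j + 1, by rw [pow_succ, ← hj, Nat.div_mul_cancel hd]⟩
  · exact absurd rfl hi

lemma prod_additive [DecidableEq F] (U : Finset F) (h0 : (0:F) ∈ U) (hadd : ∀ x ∈ U, ∀ y ∈ U, x + y ∈ U)
    (hneg : ∀ x ∈ U, -x ∈ U) (y : F) :
    (∏ u ∈ U, (X - C u)).comp (X + C y) = (∏ u ∈ U, (X - C u)) + C ((∏ u ∈ U, (X - C u)).eval y) := by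
  have hm : (∏ u ∈ U, (X - C u)).Monic := monic_prod_of_monic _ _ (fun u _ => monic_X_sub_C u)
  have hnd : (∏ u ∈ U, (X - C u)).natDegree = U.card := by rw [natDegree_prod_of_monic _ _ (fun u _ => monic_X_sub_C u)]; simp
  have hpos : 0 < U.card := Finset.card_pos.mpr ⟨0, h0⟩
  have hsh : ∀ u ∈ U, (∏ w ∈ U, (X - C w)).eval (u + y) = (∏ w ∈ U, (X - C w)).eval y := by
    intro u hu
    rw [eval_prod, eval_prod]
    refine Finset.prod_bij' (fun w _ => w - u) (fun w _ => w + u) ?_ ?_ ?_ ?_ ?_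
    · intro w hw; rw [sub_eq_add_neg]; exact hadd _ hw _ (hneg _ hu)
    · intro w hw; exact hadd _ hw _ hu
    · intro w hw; ring
    · intro w hw; ring
    · intro w hw; simp; ring
  have hz : ∀ u ∈ U, (∏ w ∈ U, (X - C w)).eval u = 0 := by
    intro u hu; rw [eval_prod]; exact Finset.prod_eq_zero hu (by simp)
  generalize (∏ u ∈ U, (X - C u)) = P at *
  apply eq_of_degree_sub_lt_of_eval_finset_eq U
  · have hm2 : (P.comp (X + C y)).Monic := hm.comp_X_add_C y
    have hnd2 : (P.comp (X + C y)).natDegree = U.card := by rw [natDegree_comp, natDegree_X_add_C, mul_one, hnd]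
    have hm3 : (P + C (P.eval y)).Monic := hm.add_of_left (by
      rw [degree_eq_natDegree hm.ne_zero, hnd]
      exact lt_of_le_of_lt degree_C_le (by exact_mod_cast hpos))
    have hnd3 : (P + C (P.eval y)).natDegree = U.card := by rw [natDegree_add_C, hnd]
    have e : (P.comp (X + C y)).degree = U.card := by rw [degree_eq_natDegree hm2.ne_zero, hnd2]
    rw [← e]
    apply degree_sub_lt_left
    · rw [e, degree_eq_natDegree hm3.ne_zero, hnd3]
    · exact hm2.ne_zero
    · rw [hm2.leadingCoeff, hm3.leadingCoeff]
  · intro u hu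
    rw [eval_comp, eval_add, eval_add, eval_X, eval_C, eval_C, hsh u hu, hz u hu, zero_add]

/-- scaling invariance of the product. -/
lemma prod_scale [DecidableEq F] (U : Finset F) (ζ : F) (hζ0 : ζ ≠ 0) (h : ∀ u ∈ U, ζ * u ∈ U) (h' : ∀ u ∈ U, ζ⁻¹ * u ∈ U) :
    (∏ u ∈ U, (X - C u)).comp (C ζ * X) = C (ζ ^ U.card) * ∏ u ∈ U, (X - C u) := by
  rw [prod_comp]
  have : ∏ u ∈ U, (X - C u).comp (C ζ * X) = ∏ u ∈ U, (C ζ * (X - C u)) := by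
    refine Finset.prod_bij' (fun w _ => ζ⁻¹ * w) (fun w _ => ζ * w) ?_ ?_ ?_ ?_ ?_
    · intro w hw; exact h' w hw
    · intro w hw; exact h w hw
    · intro w hw; field_simp
    · intro w hw; field_simp
    · intro w hw
      simp only [sub_comp, X_comp, C_comp, mul_sub, ← C_mul]
      rw [← mul_assoc, mul_inv_cancel₀ hζ0, one_mul]
  rw [this, Finset.prod_mul_distrib, Finset.prod_const, C_pow]

lemma shape_deriv {p : ℕ} [Fact p.Prime] [CharP F p] {v : ℕ} (hv : 0 < v) {W : F[X]} (hW : ∀ i, W.coeff i ≠ 0 → ∃ j, v * i + 1 = p ^ j) :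
    C (v : F) * X * derivative W + W = C (W.coeff 0) := by
  ext i
  rw [coeff_add, mul_assoc, coeff_C_mul]
  rcases i with _ | i
  · simp
  · rw [coeff_X_mul, coeff_derivative, coeff_C, if_neg (by omega)]
    by_cases h : W.coeff (i+1) = 0
    · rw [h]; ring
    · obtain ⟨j, hj⟩ := hW _ h
      have hj0 : j ≠ 0 := by
        rintro rfl
        rw [pow_zero] at hj
        have : 0 < v * (i+1) := by positivity
        omega
      have hz : ((v * (i+1) + 1 : ℕ) : F) = 0 := by rw [hj]; simp [hj0]
      push_cast at hz
      linear_combination W.coeff (i+1) * hz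

lemma shape_split [Fintype F] {p : ℕ} [Fact p.Prime] [CharP F p] {v : ℕ} (hv : 0 < v) {W : F[X]} (hd : 0 < W.natDegree)
    (hW : ∀ i, W.coeff i ≠ 0 → ∃ j, v * i + 1 = p ^ j) :
    ∃ (ρ κ : ℕ) (V1 : F[X]), 0 < ρ ∧ v * ρ + 1 = p ^ κ ∧ W = C (W.coeff 0) + X ^ ρ * V1 ^ p ^ κ ∧
      V1.coeff 0 ≠ 0 ∧ (∀ i, V1.coeff i ≠ 0 → ∃ j, v * i + 1 = p ^ j) ∧ W.natDegree = ρ + p ^ κ * V1.natDegree := by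
  classical
  have hp : p.Prime := Fact.out
  have hex : ∃ ρ, 0 < ρ ∧ W.coeff ρ ≠ 0 := ⟨W.natDegree, hd, by
    rw [coeff_natDegree]; intro h; rw [leadingCoeff_eq_zero] at h; rw [h] at hd; simp at hd⟩
  obtain ⟨ρ, ⟨hρ, hWρ⟩, hmin⟩ : ∃ ρ, (0 < ρ ∧ W.coeff ρ ≠ 0) ∧ ∀ i < ρ, ¬ (0 < i ∧ W.coeff i ≠ 0) :=
    ⟨Nat.find hex, Nat.find_spec hex, fun i hi => Nat.find_min hex hi⟩
  obtain ⟨κ, hκ⟩ := hW ρ hWρ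
  have hκ0 : κ ≠ 0 := by
    rintro rfl; rw [pow_zero] at hκ
    have : 0 < v * ρ := by positivity
    omega
  have hcop : Nat.Coprime (p ^ κ) v := by
    rw [← hκ]; simp
  have hdvd : X ^ ρ ∣ W - C (W.coeff 0) := by
    rw [X_pow_dvd_iff]
    intro i hi
    rw [coeff_sub, coeff_C]
    rcases Nat.eq_zero_or_pos i with rfl | h
    · simp
    · rw [if_neg (by omega), sub_zero]
      by_contra hc; exact hmin i hi ⟨h, hc⟩
  obtain ⟨V, hV⟩ := hdvd
  have hVc : ∀ i, V.coeff i = W.coeff (i + ρ) := by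
    intro i
    have := congrArg (fun f => f.coeff (i + ρ)) hV
    simp only [coeff_sub, coeff_C, coeff_X_pow_mul] at this
    rw [if_neg (by omega), sub_zero] at this
    exact this.symm
  have hVs : ∀ i, V.coeff i ≠ 0 → ∃ i' j, i = p ^ κ * i' ∧ v * i' + 1 = p ^ j := by
    intro i hi
    rw [hVc] at hi
    obtain ⟨j, hj⟩ := hW _ hi
    have e : v * i + p ^ κ = p ^ j := by rw [← hκ, ← hj]; ring
    have hκj : κ ≤ j := by
      apply (Nat.pow_le_pow_iff_right hp.one_lt).mp; omega
    obtain ⟨l, rfl⟩ := Nat.exists_eq_add_of_le hκj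
    have hd : p ^ κ ∣ v * i := by
      apply (Nat.dvd_add_left (dvd_refl (p ^ κ))).mp
      rw [e, pow_add]; exact dvd_mul_right _ _
    obtain ⟨i', rfl⟩ := hcop.dvd_of_dvd_mul_left hd
    refine ⟨i', l, rfl, ?_⟩
    apply Nat.eq_of_mul_eq_mul_left (pow_pos hp.pos κ)
    rw [← pow_add, ← e]; ring
  have hpκ : p ^ κ ≠ 0 := (pow_pos hp.pos κ).ne'
  choose σ hσ using fun c : F => exists_root_pp (p := p) c κ
  have hσ0 : σ 0 = 0 := by
    have := hσ 0
    exact (pow_eq_zero_iff hpκ).mp this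
  let V1 : F[X] := ∑ i ∈ Finset.range (V.natDegree + 1), C (σ (V.coeff (p ^ κ * i))) * X ^ i
  have hV1c : ∀ i, V1.coeff i = σ (V.coeff (p ^ κ * i)) := by
    intro i
    simp only [V1, finsetSum_coeff, coeff_C_mul_X_pow]
    by_cases h : i < V.natDegree + 1
    · rw [Finset.sum_eq_single i] <;> simp <;> omega
    · rw [Finset.sum_eq_zero, coeff_eq_zero_of_natDegree_lt, hσ0]
      · have : 1 * i ≤ p ^ κ * i := Nat.mul_le_mul_right _ (Nat.pos_of_ne_zero hpκ)
        omega
      · intro x hx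
        rw [Finset.mem_range] at hx
        rw [if_neg (by omega)]
  have hVV : V = V1 ^ p ^ κ := by
    ext i
    rw [coeff_pow_pp]
    split_ifs with h
    · rw [hV1c, hσ, Nat.mul_div_cancel' h]
    · by_contra hc
      obtain ⟨i', j, h1, h2⟩ := hVs i hc
      exact h ⟨i', h1⟩
  have hV1nz : ∀ i, V1.coeff i ≠ 0 → V.coeff (p ^ κ * i) ≠ 0 := by
    intro i hi h; rw [hV1c, h, hσ0] at hi; exact hi rfl
  have hW2 : W = C (W.coeff 0) + X ^ ρ * V1 ^ p ^ κ := by rw [← hVV, ← hV]; ring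
  have hV10 : V1.coeff 0 ≠ 0 := by
    intro h
    have h2 := hσ (V.coeff (p ^ κ * 0))
    rw [← hV1c, h, zero_pow hpκ, mul_zero, hVc, zero_add] at h2
    exact hWρ h2.symm
  refine ⟨ρ, κ, V1, hρ, hκ, hW2, hV10, ?_, ?_⟩
  · intro i hi
    obtain ⟨i', j, h1, h2⟩ := hVs _ (hV1nz i hi)
    have : i = i' := Nat.eq_of_mul_eq_mul_left (Nat.pos_of_ne_zero hpκ) h1
    exact ⟨j, by rw [this]; exact h2⟩
  · have hne : V1 ≠ 0 := by intro h; rw [h] at hV10; simp at hV10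
    rw [← natDegree_sub_C (a := W.coeff 0), hV, hVV, natDegree_mul (pow_ne_zero _ X_ne_zero) (pow_ne_zero _ hne),
      natDegree_pow, natDegree_pow, natDegree_X, mul_one]

end MV

namespace MV
variable {F : Type*} [Field F]

lemma exists_prim [Fintype F] {v : ℕ} (hv : 0 < v) (hd : v ∣ Fintype.card F - 1) : ∃ ζ : F, ζ ≠ 0 ∧ ζ ^ v = 1 ∧
    ∀ a b, ζ ^ a = ζ ^ b → a ≡ b [MOD v] := by
  classical
  obtain ⟨g, hg⟩ := IsCyclic.exists_ofOrder_eq_natCard (α := Fˣ)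
  rw [Nat.card_eq_fintype_card, Fintype.card_units] at hg
  obtain ⟨w, hw⟩ := hd
  have hq := Fintype.one_lt_card (α := F)
  have hw0 : w ≠ 0 := by rintro rfl; rw [mul_zero] at hw; omega
  have ho : orderOf (g ^ w) = v := by
    rw [orderOf_pow_of_dvd hw0 (by rw [hg, hw]; exact dvd_mul_left _ _), hg, hw, Nat.mul_div_cancel _ (Nat.pos_of_ne_zero hw0)]
  refine ⟨((g ^ w : Fˣ) : F), Units.ne_zero _, ?_, ?_⟩
  · rw [← Units.val_pow_eq_pow_val, ← ho, pow_orderOf_eq_one, Units.val_one]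
  · intro a b hab
    rw [← Units.val_pow_eq_pow_val, ← Units.val_pow_eq_pow_val, Units.val_inj, pow_eq_pow_iff_modEq, ho] at hab
    exact hab

lemma part1 [Fintype F] [DecidableEq F] {p : ℕ} [Fact p.Prime] [CharP F p] {n K v : ℕ} (hn : 0 < n)
    (hq : Fintype.card F = p ^ n) (hv : 0 < v) (hvd : v ∣ p ^ K - 1) (hvq : v ∣ p ^ n - 1)
    (U : Finset F) (hUcard : U.card = p ^ K) (h0 : (0:F) ∈ U) (hadd : ∀ x ∈ U, ∀ y ∈ U, x + y ∈ U)
    (hneg : ∀ x ∈ U, -x ∈ U) (hζ : ∀ ζ : F, ζ ^ v = 1 → ∀ u ∈ U, ζ * u ∈ U) (h1 : (1 : F) ∈ U)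
    (hUv : 2 < (U.image (fun u => u ^ v)).card)
    (hbig : p ^ n < (p * (U.image (fun u => u ^ v)).card) ^ 2)
    (hU : U ≠ Finset.univ.filter (fun c : F => c ^ p ^ K = c)) :
    MVSPset (U.image (fun u => u ^ v)) = {g | ∃ f ∈ MVSPset U, g = f ^ v} := by
  have hp : p.Prime := Fact.out
  have hMpos : 0 < p ^ K := pow_pos hp.pos _
  obtain ⟨r, hr⟩ := hvd
  have hM : v * r + 1 = p ^ K := by omega
  have hM2 : 2 < p ^ K := by rw [← hUcard]; exact hUv.trans_le Finset.card_image_le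
  have hr0 : 0 < r := by
    apply Nat.pos_of_ne_zero; rintro rfl; rw [mul_zero] at hr; omega
  have hUq : p ^ K ≤ p ^ n := by rw [← hUcard, ← hq]; exact Finset.card_le_univ U
  have hKn : K ≤ n := (Nat.pow_le_pow_iff_right hp.one_lt).mp hUq
  obtain ⟨P, hP⟩ : ∃ P : F[X], P = ∏ u ∈ U, (X - C u) := ⟨_, rfl⟩
  have hPm : P.Monic := by rw [hP]; exact monic_prod_of_monic _ _ (fun u _ => monic_X_sub_C u)
  have hPd : P.natDegree = p ^ K := by
    rw [hP, natDegree_prod_of_monic _ _ (fun u _ => monic_X_sub_C u)]; simp [hUcard]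
  have hPz : ∀ u ∈ U, P.eval u = 0 := by
    intro u hu; rw [hP, eval_prod]; exact Finset.prod_eq_zero hu (by simp)
  have hP0 : P.coeff 0 = 0 := by rw [coeff_zero_eq_eval_zero]; exact hPz 0 h0
  have hP1 : P.coeff 1 ≠ 0 := by
    rw [hP, ← Finset.mul_prod_erase U _ h0, C_0, sub_zero, coeff_X_mul, coeff_zero_eq_eval_zero, eval_prod]
    rw [Finset.prod_ne_zero_iff]
    intro u hu
    simp
    exact (Finset.mem_erase.mp hu).1
  have hPpow : ∀ i, P.coeff i ≠ 0 → ∃ j, i = p ^ j := by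
    apply lin (p := p) _ P le_rfl (by rw [hPd, hq]; exact hUq)
    intro y; rw [hP]; exact prod_additive U h0 hadd hneg y
  have hPv : ∀ i, P.coeff i ≠ 0 → ∃ i', i = v * i' + 1 := by
    intro i hi
    obtain ⟨ζ, hζ0, hζv, hζm⟩ := exists_prim (F := F) hv (by rw [hq]; exact hvq)
    have e := prod_scale U ζ hζ0 (hζ ζ hζv) (hζ ζ⁻¹ (by rw [inv_pow, hζv, inv_one]))
    rw [← hP, hUcard] at e
    have e2 := congrArg (fun f => f.coeff i) e
    simp only [comp_C_mul_X_coeff, coeff_C_mul] at e2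
    have e3 : ζ ^ p ^ K = ζ ^ i := by
      apply mul_right_cancel₀ hi
      rw [← e2]; ring
    have e4 := hζm _ _ e3
    rw [← hM] at e4
    have hi1 : 1 ≤ i := by
      apply Nat.pos_of_ne_zero; rintro rfl; exact hi hP0
    have e5 : 1 ≡ i [MOD v] := by
      refine Nat.ModEq.trans ?_ e4
      simp [Nat.ModEq]
    obtain ⟨i', hi'⟩ := (Nat.modEq_iff_dvd' hi1).mp e5
    exact ⟨i', by omega⟩
  -- the polynomial W
  let W : F[X] := ∑ i ∈ Finset.range (r + 1), C (P.coeff (v * i + 1)) * X ^ i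
  have hWc : ∀ i, W.coeff i = P.coeff (v * i + 1) := by
    intro i
    simp only [W, finsetSum_coeff, coeff_C_mul_X_pow]
    by_cases h : i < r + 1
    · rw [Finset.sum_eq_single i] <;> simp <;> omega
    · rw [Finset.sum_eq_zero, coeff_eq_zero_of_natDegree_lt]
      · rw [hPd, ← hM]
        have : v * (r + 1) ≤ v * i := Nat.mul_le_mul_left _ (by omega)
        have : v * (r+1) = v * r + v := by ring
        omega
      · intro x hx
        rw [Finset.mem_range] at hx
        rw [if_neg (by omega)]
  clear_value W
  have hWr : W.coeff r = 1 := by rw [hWc, hM, ← hPd]; exact hPm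
  have hWd : W.natDegree = r := by
    apply natDegree_eq_of_le_of_coeff_ne_zero
    · rw [natDegree_le_iff_coeff_eq_zero]
      intro i hi
      rw [hWc]
      apply coeff_eq_zero_of_natDegree_lt
      rw [hPd, ← hM]
      have : v * r < v * i := Nat.mul_lt_mul_of_pos_left hi hv
      omega
    · rw [hWr]; exact one_ne_zero
  have hWm : W.Monic := by rw [Monic, leadingCoeff, hWd, hWr]
  have hWP : X * expand F v W = P := by
    ext i
    rcases i with _ | i
    · simp [hP0]
    · rw [coeff_X_mul, coeff_expand hv]
      split_ifs with h
      · rw [hWc, Nat.mul_div_cancel' h]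
      · by_contra hc
        obtain ⟨i', hi'⟩ := hPv (i+1) (Ne.symm hc)
        exact h ⟨i', by omega⟩
  have hWs : ∀ i, W.coeff i ≠ 0 → ∃ j, v * i + 1 = p ^ j := by
    intro i hi; rw [hWc] at hi; exact hPpow _ hi
  have hWz : ∀ u ∈ U, u * W.eval (u ^ v) = 0 := by
    intro u hu
    have := hPz u hu
    rw [← hWP, eval_mul, eval_X, expand_eval] at this
    exact this
  have hSz : ∀ s ∈ U.image (fun u => u ^ v), s * W.eval s = 0 := by
    intro s hs
    obtain ⟨u, hu, rfl⟩ := Finset.mem_image.mp hs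
    rcases mul_eq_zero.mp (hWz u hu) with h | h
    · simp [h, hv.ne']
    · simp [h]
  have hSc : (U.image (fun u => u ^ v)).card = r + 1 := by
    apply le_antisymm _ (card_image_pow hv U (by rw [hUcard, hM]) h0)
    have hne : X * W ≠ 0 := mul_ne_zero X_ne_zero hWm.ne_zero
    have hsub : U.image (fun u => u ^ v) ⊆ (X * W).roots.toFinset := by
      intro s hs
      rw [Multiset.mem_toFinset, mem_roots hne, IsRoot, eval_mul, eval_X]
      exact hSz s hs
    refine (Finset.card_le_card hsub).trans ((Multiset.toFinset_card_le _).trans ((card_roots' _).trans ?_))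
    rw [natDegree_X_mul hWm.ne_zero, hWd]
  rw [hSc] at hUv hbig
  obtain ⟨ρ, κ, V1, hρ, hvρ, hW2, hV0, hVs, hWdeg⟩ := shape_split (p := p) hv (by rw [hWd]; exact hr0) hWs
  have hW1 := shape_deriv (p := p) hv hWs
  have hV := shape_deriv (p := p) hv hVs
  rw [hWd] at hWdeg
  have ha0 : W.coeff 0 ≠ 0 := by rw [hWc]; simpa using hP1
  have hρr : ρ < r := by
    by_contra hcon
    have hρe : ρ = r := by omega
    have hVd : p ^ κ * V1.natDegree = 0 := by omega
    have hVd0 : V1.natDegree = 0 := by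
      rcases mul_eq_zero.mp hVd with h | h
      · exact absurd h (pow_pos hp.pos _).ne'
      · exact h
    obtain ⟨b, hb⟩ : ∃ b, V1 ^ p ^ κ = C b := ⟨V1.coeff 0 ^ p ^ κ, by
      rw [C_pow, ← eq_C_of_natDegree_eq_zero hVd0]⟩
    rw [hρe, hb] at hW2
    have hb1 : b = 1 := by
      have := congrArg (fun f => f.coeff r) hW2
      simp only [coeff_add, coeff_C, coeff_X_pow_mul', le_refl, if_true, hWr, hr0.ne', if_false] at this
      simpa using this.symm
    rw [hb1, C_1, mul_one] at hW2
    have hWe : ∀ x, W.eval x = W.coeff 0 + x ^ r := by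
      intro x
      conv_lhs => rw [hW2]
      simp
    have ha1 : W.coeff 0 = -1 := by
      have := hWz 1 h1
      rw [hWe] at this
      simp at this
      linear_combination this
    apply hU
    apply Finset.eq_of_subset_of_card_le
    · intro u hu
      rw [Finset.mem_filter]
      refine ⟨Finset.mem_univ _, ?_⟩
      have := hWz u hu
      rw [hWe, ha1, ← pow_mul] at this
      rw [← hM, pow_succ]
      linear_combination this
    · have := card_filter_pow_le (F := F) (d := v * r) (by positivity)
      rw [hM] at this
      rw [hUcard]; exact this
  have hκK : κ < K := by
    apply (Nat.pow_lt_pow_iff_right hp.one_lt).mp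
    rw [← hvρ, ← hM]
    have : v * ρ < v * r := Nat.mul_lt_mul_of_pos_left hρr hv
    omega
  refine wrap hv (by omega) U (by rw [hUcard, hM]) hSc hζ h0 ?_
  intro g hg
  obtain ⟨hg1, hg2, hg3⟩ := deg_bound hSc hg
  exact core (p := p) hn hq hv (by omega) hM hKn hWm hWd ha0 hV0 hW1 hW2 hρ hvρ hV hbig
    (Or.inl ⟨hρr, hκK, hWdeg⟩) hg1 (by rw [← hq]; exact hg2) (fun a => hSz _ (hg3 a))

end MV

theorem stmt_5 (p n k v m : ℕ) (hp : p.Prime) (hn : 0 < n) (hk : k ∣ n)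
    (hv : 0 < v) (hvd : v ∣ p ^ k - 1)
    (F : Type) [Field F] [Fintype F] [DecidableEq F]
    (hcard : Fintype.card F = p ^ n)
    (U : Finset F) (hU : IsSubspaceOver (p ^ k) (↑U : Set F)) (h1 : (1 : F) ∈ U)
    (hUcard : U.card = p ^ (m * k))
    (hUv : 2 < (U.image (fun u => u ^ v)).card)
    (hbig : p ^ n < (p * (U.image (fun u => u ^ v)).card) ^ 2) :
    (U ≠ Finset.univ.filter (fun c : F => c ^ p ^ (m * k) = c) →
      MVSPset (U.image (fun u => u ^ v)) = {g | ∃ f ∈ MVSPset U, g = f ^ v}) ∧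
    (U = Finset.univ.filter (fun c : F => c ^ p ^ (m * k) = c) →
      ∀ e t : ℕ, 0 < e → (∀ s ∈ U.image (fun u => u ^ v), s ^ p ^ e = s) →
        (∀ e', 0 < e' → (∀ s ∈ U.image (fun u => u ^ v), s ^ p ^ e' = s) → e ≤ e') →
        t * (p ^ (m * k) - 1) = v * (p ^ e - 1) →
        MVSPset (U.image (fun u => u ^ v)) =
          {g | ∃ f ∈ MVSPset (Finset.univ.filter (fun c : F => c ^ p ^ e = c)), g = f ^ t}) := by
  haveI : Fact p.Prime := ⟨hp⟩
  haveI : CharP F p := by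
    have hz : ((p : ℕ) : F) = 0 := by
      have h := Nat.cast_card_eq_zero F
      rw [hcard, Nat.cast_pow] at h
      exact (pow_eq_zero_iff hn.ne').mp h
    exact (CharP.charP_iff_prime_eq_zero hp).mpr hz
  have hvd2 : v ∣ p ^ (m * k) - 1 := hvd.trans (Nat.pow_sub_one_dvd_pow_sub_one p (dvd_mul_left _ _))
  have hvq : v ∣ p ^ n - 1 := hvd.trans (Nat.pow_sub_one_dvd_pow_sub_one p hk)
  obtain ⟨h0, hadd, hneg, hmul⟩ := hU
  refine ⟨fun hne => ?_, fun heq e t he h2 h3 h4 => ?_⟩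
  · refine MV.part1 hn hcard hv hvd2 hvq U hUcard (by simpa using h0) (by simpa using hadd) (by simpa using hneg) ?_ h1 hUv hbig hne
    intro ζ hζ u hu
    have : ζ * u ∈ (U : Set F) := by
      apply hmul ζ _ u (by simpa using hu)
      obtain ⟨w, hw⟩ := hvd
      have hpos : 0 < p ^ k := pow_pos hp.pos _
      rw [show p ^ k = (p ^ k - 1) + 1 by omega, pow_succ, hw, pow_mul, hζ, one_pow, one_mul]
    simpa using this
  · exact MV.part2 hn hcard hv hvd2 U hUcard hUv hbig heq e t he h2 h3 h4
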